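/- arXiv:1105.1621 — 4 statements merged into one kernel-verified Lean document; each statement's English description precedes it below -/
import Mathlib

section
/- There are infinitely many positive integers $n$ such that $n$ and $n+1$ have the same number of distinct prime factors, i.e., $\omega(n) = \omega(n+1)$. -/
open Finset

/-- A finite set `F` of positive integers in which every difference divides both of its terms, all
primes dividing a difference divide `Q`, and for any two members each has the larger valuation at
equally many primes dividing `Q`. -/
structure BalancedFamily (F : Finset ℕ) (Q : ℕ) : Prop where
  ne_zero : Q ≠ 0
  two_dvd : 2 ∣ Q
  pos : ∀ a ∈ F, 0 < a
  sub_dvd : ∀ a ∈ F, ∀ b ∈ F, a < b → b - a ∣ a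
  prime_dvd : ∀ a ∈ F, ∀ b ∈ F, a < b → ∀ p, p.Prime → p ∣ b - a → p ∣ Q
  balanced : ∀ a ∈ F, ∀ b ∈ F,
    #{p ∈ Q.primeFactors | a.factorization p < b.factorization p} =
      #{p ∈ Q.primeFactors | b.factorization p < a.factorization p}

theorem mem_primeFactors_succ_iff {d v p : ℕ} (hd : d ≠ 0) (hv : v ≠ 0) (hp : p.Prime) :
    p ∣ v + 1 ↔ (d * v).factorization p < (d * (v + 1)).factorization p := by
  rw [Nat.factorization_mul hd hv, Nat.factorization_mul hd (by omega)]
  simp only [Finsupp.add_apply, add_lt_add_iff_left]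
  constructor
  · intro h
    have h1 : ¬ p ∣ v := fun h2 => hp.one_lt.ne' (Nat.dvd_one.1 ((Nat.dvd_add_right h2).1 h))
    rw [Nat.factorization_eq_zero_of_not_dvd h1]
    exact hp.factorization_pos_of_dvd (by omega) h
  · intro h
    exact Nat.dvd_of_factorization_pos (by omega)

theorem mem_primeFactors_pred_iff {d v p : ℕ} (hd : d ≠ 0) (hv : v ≠ 0) (hp : p.Prime) :
    p ∣ v ↔ (d * (v + 1)).factorization p < (d * v).factorization p := by
  rw [Nat.factorization_mul hd hv, Nat.factorization_mul hd (by omega)]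
  simp only [Finsupp.add_apply, add_lt_add_iff_left]
  constructor
  · intro h
    have h1 : ¬ p ∣ v + 1 := fun h2 => hp.one_lt.ne' (Nat.dvd_one.1 ((Nat.dvd_add_right h).1 h2))
    rw [Nat.factorization_eq_zero_of_not_dvd h1]
    exact hp.factorization_pos_of_dvd (by omega) h
  · intro h
    exact Nat.dvd_of_factorization_pos (by omega)

theorem card_primeFactors_eq_add {n Q : ℕ} (hQ : Q ≠ 0) :
    #n.primeFactors = #{p ∈ Q.primeFactors | p ∣ n ∧ n ≠ 0} + #{p ∈ n.primeFactors | ¬ p ∣ Q} := by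
  rw [← card_filter_add_card_filter_not (s := n.primeFactors) (fun p => p ∣ Q)]
  congr 2
  ext p
  simp only [mem_filter, Nat.mem_primeFactors]
  tauto

theorem BalancedFamily.card_primeFactors_eq {F : Finset ℕ} {Q : ℕ} (h : BalancedFamily F Q)
    {a b : ℕ} (ha : a ∈ F) (hb : b ∈ F) (hab : a < b)
    (heq : #{p ∈ a.primeFactors | ¬ p ∣ Q} = #{p ∈ b.primeFactors | ¬ p ∣ Q}) :
    #(a / (b - a)).primeFactors = #(a / (b - a) + 1).primeFactors := by
  obtain ⟨v, hv⟩ := h.sub_dvd a ha b hb hab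
  have ha0 := h.pos a ha
  have hpd := h.prime_dvd a ha b hb hab
  have hbal := h.balanced a ha b hb
  generalize hd : b - a = d at *
  have hd0 : d ≠ 0 := by omega
  have hb' : b = d * (v + 1) := by rw [mul_add, ← hv]; omega
  have hv0 : v ≠ 0 := by rintro rfl; omega
  clear hd
  subst hv
  subst hb'
  rw [Nat.mul_div_cancel_left _ (by omega), card_primeFactors_eq_add h.ne_zero (n := v),
    card_primeFactors_eq_add h.ne_zero (n := v + 1)]
  have h1 : ∀ w, w ≠ 0 → {p ∈ (d * w).primeFactors | ¬ p ∣ Q} = {p ∈ w.primeFactors | ¬ p ∣ Q} := by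
    intro w hw
    ext p
    simp only [mem_filter, Nat.mem_primeFactors]
    constructor
    · rintro ⟨⟨hp, h2, h3⟩, h4⟩
      refine ⟨⟨hp, ?_, hw⟩, h4⟩
      rcases hp.dvd_mul.1 h2 with h5 | h5
      · exact absurd (hpd p hp h5) h4
      · exact h5
    · rintro ⟨⟨hp, h2, h3⟩, h4⟩
      exact ⟨⟨hp, h2.mul_left _, by positivity⟩, h4⟩
  rw [h1 v hv0, h1 (v + 1) (by omega)] at heq
  rw [heq]
  congr 1
  convert hbal.symm using 2
  · apply filter_congr
    intro p hp
    rw [← mem_primeFactors_pred_iff hd0 hv0 (Nat.prime_of_mem_primeFactors hp)]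
    tauto
  · apply filter_congr
    intro p hp
    rw [← mem_primeFactors_succ_iff hd0 hv0 (Nat.prime_of_mem_primeFactors hp)]
    simp

theorem factorization_eq_of_pow_dvd_sub {a A p : ℕ} (hp : p.Prime) (ha : a ≠ 0) (hA : A ≠ 0) {e : ℕ}
    (he : a.factorization p < e) (h : A ≡ a [MOD p ^ e]) : A.factorization p = a.factorization p := by
  have key : ∀ k ≤ e, p ^ k ∣ A ↔ p ^ k ∣ a := fun k hk =>
    (h.of_dvd (pow_dvd_pow p hk)).dvd_iff dvd_rfl
  apply le_antisymm
  · by_contra! hlt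
    have := (key (a.factorization p + 1) he).1
      ((hp.pow_dvd_iff_le_factorization hA).2 hlt)
    rw [hp.pow_dvd_iff_le_factorization ha] at this
    omega
  · rw [← hp.pow_dvd_iff_le_factorization hA, key _ he.le]
    exact Nat.ordProj_dvd a p

theorem BalancedFamily.eq_of_prime_dvd {F : Finset ℕ} {Q : ℕ} (h : BalancedFamily F Q) {a b p n : ℕ}
    (ha : a ∈ F) (hb : b ∈ F) (hp : p.Prime) (hpQ : ¬ p ∣ Q) (hpa : p ∣ n + a) (hpb : p ∣ n + b) :
    a = b := by
  rcases lt_trichotomy a b with hlt | heq | hlt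
  · refine absurd (h.prime_dvd a ha b hb hlt p hp ?_) hpQ
    have := Nat.dvd_sub hpb hpa
    rwa [Nat.add_sub_add_left] at this
  · exact heq
  · refine absurd (h.prime_dvd b hb a ha hlt p hp ?_) hpQ
    have := Nat.dvd_sub hpa hpb
    rwa [Nat.add_sub_add_left] at this

/-- The congruences on `A` under which adjoining `A` to the translate `A + F` keeps the family
balanced. -/
structure ExtensionCongruences (F W : Finset ℕ) (Q : ℕ) (g : ℕ → ℕ) (A : ℕ) : Prop where
  of_dvd : ∀ p, p.Prime → p ∣ Q → A ≡ 0 [MOD p ^ ((Q * ∏ a ∈ F, a).factorization p + 1)]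
  of_dvd_mem : ∀ p, p.Prime → ¬ p ∣ Q → ∀ a ∈ F, p ∣ a →
    A ≡ a [MOD p ^ ((Q * ∏ a ∈ F, a).factorization p + 1)]
  of_mem : ∀ p ∈ W, p ∣ A + g p

section Extension

variable {F W : Finset ℕ} {Q A : ℕ} {g : ℕ → ℕ}

theorem BalancedFamily.mul_prod_ne_zero (h : BalancedFamily F Q) : Q * ∏ a ∈ F, a ≠ 0 :=
  mul_ne_zero h.ne_zero (prod_ne_zero_iff.2 fun a ha => (h.pos a ha).ne')

theorem BalancedFamily.factorization_le (h : BalancedFamily F Q) {a : ℕ} (ha : a ∈ F) (p : ℕ) :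
    a.factorization p ≤ (Q * ∏ a ∈ F, a).factorization p :=
  (Nat.factorization_le_iff_dvd (h.pos a ha).ne' h.mul_prod_ne_zero).2
    ((dvd_prod_of_mem _ ha).mul_left _) p

theorem BalancedFamily.factorization_of_dvd (h : BalancedFamily F Q)
    (hA : ExtensionCongruences F W Q g A) (hA0 : A ≠ 0) {p a : ℕ} (hp : p.Prime) (hpQ : p ∣ Q)
    (ha : a ∈ F) :
    a.factorization p < A.factorization p ∧ (A + a).factorization p = a.factorization p := by
  have h1 := hA.of_dvd p hp hpQ
  have h2 := h.factorization_le ha p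
  have h3 := (hp.pow_dvd_iff_le_factorization hA0).1 ((Nat.modEq_zero_iff_dvd).1 h1)
  refine ⟨by omega, ?_⟩
  refine factorization_eq_of_pow_dvd_sub hp (h.pos a ha).ne' (by omega)
    (e := (Q * ∏ a ∈ F, a).factorization p + 1) (by omega) ?_
  simpa using h1.add_right a

theorem BalancedFamily.factorization_of_dvd_mem (h : BalancedFamily F Q)
    (hA : ExtensionCongruences F W Q g A) (hA0 : A ≠ 0) {p a : ℕ} (hp : p.Prime) (hpQ : ¬ p ∣ Q)
    (ha : a ∈ F) (hpa : p ∣ a) :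
    A.factorization p = a.factorization p ∧ (A + a).factorization p = a.factorization p := by
  have h1 := hA.of_dvd_mem p hp hpQ a ha hpa
  have h2 := h.factorization_le ha p
  have ha0 := (h.pos a ha).ne'
  refine ⟨factorization_eq_of_pow_dvd_sub hp ha0 hA0
    (e := (Q * ∏ a ∈ F, a).factorization p + 1) (by omega) h1, ?_⟩
  have h3 : (2 * a).factorization p = a.factorization p := by
    have hp2 : ¬ p ∣ 2 := fun h2 => hpQ (h2.trans h.two_dvd)
    rw [Nat.factorization_mul two_ne_zero ha0]
    simp [Nat.factorization_eq_zero_of_not_dvd hp2]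
  rw [← h3]
  refine factorization_eq_of_pow_dvd_sub hp (by omega) (by omega)
    (e := (Q * ∏ a ∈ F, a).factorization p + 1) (by omega) ?_
  simpa [two_mul] using h1.add_right a

theorem BalancedFamily.dvd_of_extensionCongruences (h : BalancedFamily F Q)
    (hA : ExtensionCongruences F W Q g A) (hA0 : A ≠ 0) {a : ℕ} (ha : a ∈ F) : a ∣ A := by
  rw [← Nat.factorization_le_iff_dvd (h.pos a ha).ne' hA0]
  intro p
  by_cases hp : p.Prime
  · by_cases hpQ : p ∣ Q
    · exact (h.factorization_of_dvd hA hA0 hp hpQ ha).1.le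
    · by_cases hpa : p ∣ a
      · exact (h.factorization_of_dvd_mem hA hA0 hp hpQ ha hpa).1.ge
      · simp [Nat.factorization_eq_zero_of_not_dvd hpa]
  · simp [Nat.factorization_eq_zero_of_not_prime _ hp]

theorem ExtensionCongruences.not_dvd (hA : ExtensionCongruences F W Q g A)
    (hg : ∀ q ∈ W, g q ∈ F)
    (hW : ∀ q ∈ W, q.Prime ∧ ¬ q ∣ Q * ∏ a ∈ F, a) {q : ℕ} (hq : q ∈ W) : ¬ q ∣ A := fun hqA =>
  (hW q hq).2 <| (((Nat.dvd_add_right hqA).1 (hA.of_mem q hq)).trans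
    (dvd_prod_of_mem (fun a => a) (hg q hq))).mul_left _

theorem BalancedFamily.not_dvd_add_of_dvd_mem (h : BalancedFamily F Q)
    (hA : ExtensionCongruences F W Q g A) (hA0 : A ≠ 0) {p a b : ℕ} (hp : p.Prime) (hpQ : ¬ p ∣ Q)
    (ha : a ∈ F) (hpa : p ∣ a) (hb : b ∈ F) (hab : a ≠ b) : ¬ p ∣ A + b := fun hpb =>
  hab <| h.eq_of_prime_dvd ha hb hp hpQ
    (((hpa.trans (h.dvd_of_extensionCongruences hA hA0 ha)).add hpa)) hpb

theorem card_filter_primeFactors_union (hQ : Q ∣ A) (hA0 : A ≠ 0)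
    (hW : ∀ q ∈ W, q.Prime ∧ ¬ q ∣ A) (R : ℕ → Prop) [DecidablePred R] :
    #{p ∈ A.primeFactors ∪ W | R p} = #{p ∈ Q.primeFactors | R p} +
      #{p ∈ A.primeFactors | ¬ p ∣ Q ∧ R p} + #{p ∈ W | R p} := by
  rw [filter_union, card_union_of_disjoint]
  · congr 1
    rw [← card_filter_add_card_filter_not (s := {p ∈ A.primeFactors | R p}) (fun p => p ∣ Q)]
    congr 2
    · ext p
      simp only [mem_filter, Nat.mem_primeFactors]
      have := fun hp : p ∣ Q => hp.trans hQ
      have : Q ≠ 0 := fun h => hA0 (by simpa [h] using hQ)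
      tauto
    · ext p
      simp only [mem_filter]
      tauto
  · rw [disjoint_left]
    intro p hp hp'
    simp only [mem_filter, Nat.mem_primeFactors] at hp hp'
    exact (hW p hp'.1).2 hp.1.2.1

theorem exists_mem_dvd_of_mem_primeFactors {p : ℕ}
    (hp : p ∈ (Q * ∏ a ∈ F, a).primeFactors) (hpQ : ¬ p ∣ Q) : ∃ a ∈ F, p ∣ a := by
  have hpp := Nat.prime_of_mem_primeFactors hp
  rcases hpp.dvd_mul.1 (Nat.dvd_of_mem_primeFactors hp) with h1 | h1
  · exact absurd h1 hpQ
  · exact (hpp.prime.dvd_finsetProd_iff _).1 h1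

theorem BalancedFamily.filter_dvd_eq (h : BalancedFamily F Q) {b : ℕ} (hb : b ∈ F) :
    {p ∈ (Q * ∏ a ∈ F, a).primeFactors | ¬ p ∣ Q ∧ p ∣ b} = {p ∈ b.primeFactors | ¬ p ∣ Q} := by
  ext p
  have h1 : p ∣ b → p ∣ Q * ∏ a ∈ F, a := fun h1 =>
    (h1.trans (dvd_prod_of_mem _ hb)).mul_left _
  have h2 := h.mul_prod_ne_zero
  have h3 := (h.pos b hb).ne'
  simp only [mem_filter, Nat.mem_primeFactors]
  tauto

theorem BalancedFamily.card_translate_lt_translate (h : BalancedFamily F Q)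
    (hA : ExtensionCongruences F W Q g A) (hA0 : A ≠ 0) (hg : ∀ q ∈ W, g q ∈ F)
    (hW : ∀ q ∈ W, q.Prime ∧ ¬ q ∣ Q * ∏ a ∈ F, a)
    (hcard : ∀ a ∈ F, #{q ∈ W | g q = a} + #{p ∈ a.primeFactors | ¬ p ∣ Q} =
      #(Q * ∏ a ∈ F, a).primeFactors) {a b : ℕ} (ha : a ∈ F) (hb : b ∈ F) (hab : a ≠ b) :
    #{p ∈ (Q * ∏ a ∈ F, a).primeFactors ∪ W | (A + a).factorization p < (A + b).factorization p} =
      #{p ∈ Q.primeFactors | a.factorization p < b.factorization p} +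
        #(Q * ∏ a ∈ F, a).primeFactors := by
  rw [card_filter_primeFactors_union (Q := Q) (dvd_mul_right _ _) h.mul_prod_ne_zero hW,
    ← hcard b hb, add_assoc]
  congr 1
  · congr 1
    apply filter_congr
    intro p hp
    have hpp := Nat.prime_of_mem_primeFactors hp
    have hpQ := Nat.dvd_of_mem_primeFactors hp
    rw [(h.factorization_of_dvd hA hA0 hpp hpQ ha).2, (h.factorization_of_dvd hA hA0 hpp hpQ hb).2]
  · rw [add_comm, ← h.filter_dvd_eq hb]
    congr 2
    · apply filter_congr
      intro q hq
      have hqp := (hW q hq).1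
      have hqQ : ¬ q ∣ Q := fun h1 => (hW q hq).2 (h1.mul_right _)
      have hgq := hA.of_mem q hq
      constructor
      · intro hlt
        exact h.eq_of_prime_dvd (hg q hq) hb hqp hqQ hgq (Nat.dvd_of_factorization_pos (by omega))
      · rintro rfl
        rw [Nat.factorization_eq_zero_of_not_dvd
          (fun h1 => hab (h.eq_of_prime_dvd ha hb hqp hqQ h1 hgq))]
        exact hqp.factorization_pos_of_dvd (by omega) hgq
    · apply filter_congr
      intro p hp
      have hpp := Nat.prime_of_mem_primeFactors hp
      refine and_congr_right fun hpQ => ?_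
      constructor
      · intro hlt
        obtain ⟨c, hc, hpc⟩ := exists_mem_dvd_of_mem_primeFactors hp hpQ
        by_contra hpb
        have hcb : c ≠ b := by rintro rfl; exact hpb hpc
        have := h.not_dvd_add_of_dvd_mem hA hA0 hpp hpQ hc hpc hb hcb
        rw [Nat.factorization_eq_zero_of_not_dvd this] at hlt
        omega
      · intro hpb
        rw [Nat.factorization_eq_zero_of_not_dvd
          (h.not_dvd_add_of_dvd_mem hA hA0 hpp hpQ hb hpb ha hab.symm)]
        rw [(h.factorization_of_dvd_mem hA hA0 hpp hpQ hb hpb).2]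
        exact hpp.factorization_pos_of_dvd (h.pos b hb).ne' hpb

theorem BalancedFamily.card_self_lt_translate (h : BalancedFamily F Q)
    (hA : ExtensionCongruences F W Q g A) (hA0 : A ≠ 0) (hg : ∀ q ∈ W, g q ∈ F)
    (hW : ∀ q ∈ W, q.Prime ∧ ¬ q ∣ Q * ∏ a ∈ F, a) {b : ℕ} (hb : b ∈ F) :
    #{p ∈ (Q * ∏ a ∈ F, a).primeFactors ∪ W | A.factorization p < (A + b).factorization p} =
      #{q ∈ W | g q = b} := by
  rw [card_filter_primeFactors_union (Q := Q) (dvd_mul_right _ _) h.mul_prod_ne_zero hW]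
  rw [filter_false_of_mem, filter_false_of_mem]
  · simp only [card_empty, zero_add]
    congr 1
    apply filter_congr
    intro q hq
    have hqp := (hW q hq).1
    have hqQ : ¬ q ∣ Q := fun h1 => (hW q hq).2 (h1.mul_right _)
    have hgq := hA.of_mem q hq
    constructor
    · intro hlt
      exact h.eq_of_prime_dvd (hg q hq) hb hqp hqQ hgq (Nat.dvd_of_factorization_pos (by omega))
    · rintro rfl
      rw [Nat.factorization_eq_zero_of_not_dvd (hA.not_dvd hg hW hq)]
      exact hqp.factorization_pos_of_dvd (by omega) hgq
  · intro p hp ⟨hpQ, hlt⟩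
    have hpp := Nat.prime_of_mem_primeFactors hp
    obtain ⟨c, hc, hpc⟩ := exists_mem_dvd_of_mem_primeFactors hp hpQ
    have h1 := h.factorization_of_dvd_mem hA hA0 hpp hpQ hc hpc
    rcases eq_or_ne c b with rfl | hcb
    · omega
    · rw [Nat.factorization_eq_zero_of_not_dvd
        (h.not_dvd_add_of_dvd_mem hA hA0 hpp hpQ hc hpc hb hcb)] at hlt
      omega
  · intro p hp
    have := h.factorization_of_dvd hA hA0 (Nat.prime_of_mem_primeFactors hp)
      (Nat.dvd_of_mem_primeFactors hp) hb
    omega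

theorem BalancedFamily.card_translate_lt_self (h : BalancedFamily F Q)
    (hA : ExtensionCongruences F W Q g A) (hA0 : A ≠ 0) (hg : ∀ q ∈ W, g q ∈ F)
    (hW : ∀ q ∈ W, q.Prime ∧ ¬ q ∣ Q * ∏ a ∈ F, a)
    (hcard : ∀ a ∈ F, #{q ∈ W | g q = a} + #{p ∈ a.primeFactors | ¬ p ∣ Q} =
      #(Q * ∏ a ∈ F, a).primeFactors) {b : ℕ} (hb : b ∈ F) :
    #{p ∈ (Q * ∏ a ∈ F, a).primeFactors ∪ W | (A + b).factorization p < A.factorization p} =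
      #{q ∈ W | g q = b} := by
  have h0 := hcard b hb
  have h1 := card_filter_primeFactors_union (Q := Q) (W := ∅) (dvd_mul_right _ (∏ a ∈ F, a))
    h.mul_prod_ne_zero (by simp) (fun p => ¬ p ∣ Q → ¬ p ∣ b)
  have h2 := card_filter_add_card_filter_not (s := (Q * ∏ a ∈ F, a).primeFactors)
    (fun p => ¬ p ∣ Q → ¬ p ∣ b)
  rw [card_filter_primeFactors_union (Q := Q) (dvd_mul_right _ _) h.mul_prod_ne_zero hW,
    filter_false_of_mem (s := W)]
  · rw [← h.filter_dvd_eq hb] at h0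
    simp only [Classical.not_imp, not_not, union_empty, filter_empty, card_empty] at h1 h2
    have h3 : #{p ∈ Q.primeFactors | (A + b).factorization p < A.factorization p} =
        #{p ∈ Q.primeFactors | ¬ p ∣ Q → ¬ p ∣ b} := by
      congr 1
      apply filter_congr
      intro p hp
      have hpQ := Nat.dvd_of_mem_primeFactors hp
      have := h.factorization_of_dvd hA hA0 (Nat.prime_of_mem_primeFactors hp) hpQ hb
      simp only [hpQ, not_true_eq_false, false_imp_iff, iff_true]
      omega
    have h4 : #{p ∈ (Q * ∏ a ∈ F, a).primeFactors | ¬ p ∣ Q ∧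
          (A + b).factorization p < A.factorization p} =
        #{p ∈ (Q * ∏ a ∈ F, a).primeFactors | ¬ p ∣ Q ∧ (¬ p ∣ Q → ¬ p ∣ b)} := by
      congr 1
      apply filter_congr
      intro p hp
      have hpp := Nat.prime_of_mem_primeFactors hp
      refine and_congr_right fun hpQ => ?_
      simp only [hpQ, not_false_eq_true, true_imp_iff]
      constructor
      · intro hlt hpb
        have := h.factorization_of_dvd_mem hA hA0 hpp hpQ hb hpb
        omega
      · intro hpb
        obtain ⟨c, hc, hpc⟩ := exists_mem_dvd_of_mem_primeFactors hp hpQ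
        have hcb : c ≠ b := by rintro rfl; exact hpb hpc
        rw [Nat.factorization_eq_zero_of_not_dvd
          (h.not_dvd_add_of_dvd_mem hA hA0 hpp hpQ hc hpc hb hcb)]
        exact hpp.factorization_pos_of_dvd hA0
          (hpc.trans (h.dvd_of_extensionCongruences hA hA0 hc))
    rw [h3, h4]
    simp only [card_empty] at *
    omega
  · intro q hq
    rw [Nat.factorization_eq_zero_of_not_dvd (hA.not_dvd hg hW hq)]
    omega

theorem BalancedFamily.insert_translate (h : BalancedFamily F Q)
    (hA : ExtensionCongruences F W Q g A) (hA0 : A ≠ 0) (hg : ∀ q ∈ W, g q ∈ F)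
    (hW : ∀ q ∈ W, q.Prime ∧ ¬ q ∣ Q * ∏ a ∈ F, a)
    (hcard : ∀ a ∈ F, #{q ∈ W | g q = a} + #{p ∈ a.primeFactors | ¬ p ∣ Q} =
      #(Q * ∏ a ∈ F, a).primeFactors) {Q' : ℕ} (hQ'0 : Q' ≠ 0) (hQQ' : Q * ∏ a ∈ F, a ∣ Q')
    (hQ' : Q'.primeFactors = (Q * ∏ a ∈ F, a).primeFactors ∪ W) :
    BalancedFamily (insert A (F.image (A + ·))) Q' := by
  have hFQ' : ∀ a ∈ F, a ∣ Q' := fun a ha => ((dvd_prod_of_mem _ ha).mul_left _).trans hQQ'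
  refine ⟨hQ'0, h.two_dvd.trans ((dvd_mul_right _ _).trans hQQ'), ?_, ?_, ?_, ?_⟩
  · intro a ha
    simp only [mem_insert, mem_image] at ha
    omega
  · intro a ha b hb hab
    simp only [mem_insert, mem_image] at ha hb
    rcases ha with rfl | ⟨a, ha, rfl⟩ <;> rcases hb with rfl | ⟨b, hb, rfl⟩
    · omega
    · rw [Nat.add_sub_cancel_left]
      exact h.dvd_of_extensionCongruences hA hA0 hb
    · omega
    · rw [Nat.add_sub_add_left]
      have := h.sub_dvd a ha b hb (by omega)
      exact (this.trans (h.dvd_of_extensionCongruences hA hA0 ha)).add this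
  · intro a ha b hb hab p hp hpab
    simp only [mem_insert, mem_image] at ha hb
    rcases ha with rfl | ⟨a, ha, rfl⟩ <;> rcases hb with rfl | ⟨b, hb, rfl⟩
    · omega
    · rw [Nat.add_sub_cancel_left] at hpab
      exact hpab.trans (hFQ' b hb)
    · omega
    · rw [Nat.add_sub_add_left] at hpab
      exact (hpab.trans (h.sub_dvd a ha b hb (by omega))).trans (hFQ' a ha)
  · intro a ha b hb
    simp only [mem_insert, mem_image] at ha hb
    rw [hQ']
    rcases ha with rfl | ⟨a, ha, rfl⟩ <;> rcases hb with rfl | ⟨b, hb, rfl⟩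
    · rfl
    · rw [h.card_self_lt_translate hA hA0 hg hW hb, h.card_translate_lt_self hA hA0 hg hW hcard hb]
    · rw [h.card_self_lt_translate hA hA0 hg hW ha, h.card_translate_lt_self hA hA0 hg hW hcard ha]
    · rcases eq_or_ne a b with rfl | hab
      · rfl
      · rw [h.card_translate_lt_translate hA hA0 hg hW hcard ha hb hab,
          h.card_translate_lt_translate hA hA0 hg hW hcard hb ha hab.symm, h.balanced a ha b hb]

end Extension

theorem exists_fiber_card_eq (F : Finset ℕ) (k : ℕ → ℕ) (W : Finset ℕ) (hW : #W = ∑ a ∈ F, k a) :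
    ∃ g : ℕ → ℕ, (∀ q ∈ W, g q ∈ F) ∧ ∀ a ∈ F, #{q ∈ W | g q = a} = k a := by
  induction F using Finset.induction_on generalizing W with
  | empty => exact ⟨id, by simp_all⟩
  | insert b F hb ih =>
    rw [sum_insert hb] at hW
    obtain ⟨U, hUW, hU⟩ := exists_subset_card_eq (show k b ≤ #W by omega)
    obtain ⟨g, hg, hgc⟩ := ih (W \ U) (by rw [card_sdiff_of_subset hUW]; omega)
    refine ⟨fun q => if q ∈ U then b else g q, ?_, ?_⟩
    · intro q hq
      by_cases hqU : q ∈ U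
      · simp [hqU]
      · simp [hqU, hg q (mem_sdiff.2 ⟨hq, hqU⟩)]
    · intro a ha
      rcases eq_or_ne a b with rfl | hab
      · rw [← hU]
        congr 1
        ext q
        simp only [mem_filter]
        constructor
        · rintro ⟨hq, h1⟩
          by_contra hqU
          rw [if_neg hqU] at h1
          exact hb (h1 ▸ hg q (mem_sdiff.2 ⟨hq, hqU⟩))
        · exact fun hqU => ⟨hUW hqU, if_pos hqU⟩
      · rw [← hgc a (mem_of_mem_insert_of_ne ha hab)]
        congr 1
        ext q
        by_cases hqU : q ∈ U <;> simp [hqU, hab.symm]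

theorem two_pow_le_primeCounting {k : ℕ} (hk : 3 ≤ k) : 2 ^ k ≤ #(Nat.primesLE (2 ^ (2 * k))) := by
  by_contra! hlt
  have h1 := Chebyshev.two_pow_le_mul_lcmUpto (2 ^ (2 * k))
  have h2 : Nat.lcmUpto (2 ^ (2 * k)) ≤ (2 ^ (2 * k)) ^ #(Nat.primesLE (2 ^ (2 * k))) := by
    rw [Nat.lcmUpto_eq_prod_pow_log]
    exact prod_le_pow_card _ _ _ fun p _ => Nat.pow_log_le_self p (by positivity)
  have h3 : (2 ^ (2 * k)) ^ #(Nat.primesLE (2 ^ (2 * k))) ≤ 2 ^ (2 * k * (2 ^ k - 1)) := by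
    rw [← pow_mul]
    gcongr
    · norm_num
    · omega
  have h4 : 2 ^ (2 * k) + 1 ≤ 2 ^ (2 * k + 1) := by
    have := Nat.one_le_two_pow (n := 2 * k)
    rw [pow_succ]; omega
  have h5 := h1.trans (Nat.mul_le_mul h4 (h2.trans h3))
  rw [← pow_add, Nat.pow_le_pow_iff_right (by norm_num)] at h5
  have h6 : 2 * k + 1 < 2 ^ k + 1 := by
    have : 2 * k < 2 ^ k := by
      clear hlt h1 h2 h3 h4 h5
      induction k, hk using Nat.le_induction with
      | base => norm_num
      | succ m hm ih => rw [pow_succ]; omega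
    omega
  have h7 : 2 * k * (2 ^ k - 1) + 2 * k = 2 * k * 2 ^ k := by
    have := Nat.one_le_two_pow (n := k)
    obtain ⟨c, hc⟩ := Nat.exists_eq_add_of_le this
    rw [hc]; simp; ring
  have h8 : 2 ^ (2 * k) = 2 ^ k * 2 ^ k := by rw [two_mul, pow_add]
  nlinarith

theorem exists_primes_not_dvd {N n k : ℕ} (hk : 3 ≤ k) (hn : n + #N.primeFactors ≤ 2 ^ k) :
    ∃ W : Finset ℕ, #W = n ∧ ∀ q ∈ W, q.Prime ∧ q ≤ 2 ^ (2 * k) ∧ q ∉ N.primeFactors := by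
  have h1 := le_card_sdiff N.primeFactors (Nat.primesLE (2 ^ (2 * k)))
  have h2 := two_pow_le_primeCounting hk
  obtain ⟨W, hW, hc⟩ := exists_subset_card_eq
    (show n ≤ #(Nat.primesLE (2 ^ (2 * k)) \ N.primeFactors) by omega)
  refine ⟨W, hc, fun q hq => ?_⟩
  have := mem_sdiff.1 (hW hq)
  rw [Nat.mem_primesLE] at this
  tauto

theorem two_pow_card_primeFactors_le {N : ℕ} (hN : N ≠ 0) : 2 ^ #N.primeFactors ≤ N :=
  (pow_card_le_prod _ _ _ fun _ hp => (Nat.prime_of_mem_primeFactors hp).two_le).trans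
    (Nat.le_of_dvd (by omega) (Nat.prod_primeFactors_dvd N))

section Extension

variable {F W : Finset ℕ} {Q : ℕ} {g : ℕ → ℕ}

theorem prod_pow_factorization_add_one {N : ℕ} (hN : N ≠ 0) :
    ∏ p ∈ N.primeFactors ∪ W, p ^ (N.factorization p + 1) =
      N * ∏ p ∈ N.primeFactors ∪ W, p := by
  simp_rw [pow_succ]
  rw [prod_mul_distrib]
  congr 1
  conv_rhs => rw [← Nat.prod_factorization_pow_eq_self hN]
  rw [Finsupp.prod_of_support_subset _ (s := N.primeFactors ∪ W) (by simp) _ (by simp)]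

theorem BalancedFamily.exists_extensionCongruences (h : BalancedFamily F Q)
    (hW : ∀ q ∈ W, q.Prime ∧ ¬ q ∣ Q * ∏ a ∈ F, a) :
    ∃ r < (Q * ∏ a ∈ F, a) * ∏ p ∈ (Q * ∏ a ∈ F, a).primeFactors ∪ W, p,
      ∀ A, A ≡ r [MOD (Q * ∏ a ∈ F, a) * ∏ p ∈ (Q * ∏ a ∈ F, a).primeFactors ∪ W, p] →
        ExtensionCongruences F W Q g A := by
  have hN := h.mul_prod_ne_zero
  rw [← prod_pow_factorization_add_one hN]
  have hFN : ∀ a ∈ F, a ∣ Q * ∏ a ∈ F, a := fun a ha => (dvd_prod_of_mem _ ha).mul_left _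
  set N := Q * ∏ a ∈ F, a with hNdef
  have hTp : ∀ p ∈ N.primeFactors ∪ W, p.Prime := by
    intro p hp
    rcases mem_union.1 hp with hp | hp
    · exact Nat.prime_of_mem_primeFactors hp
    · exact (hW p hp).1
  have hc : ∀ p : ℕ, ∃ c, (p ∣ Q → c ≡ 0 [MOD p ^ (N.factorization p + 1)]) ∧
      (p.Prime → ¬ p ∣ Q → ∀ a ∈ F, p ∣ a → c ≡ a [MOD p ^ (N.factorization p + 1)]) ∧
      (p ∈ W → p ∣ c + g p) := by
    intro p
    by_cases hpW : p ∈ W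
    · refine ⟨(p - 1) * g p, fun hpQ => ?_, fun _ _ a ha hpa => ?_, fun _ => ?_⟩
      · exact absurd (hpQ.mul_right _) (hW p hpW).2
      · exact absurd (hpa.trans (hFN a ha)) (hW p hpW).2
      · have := (hW p hpW).1.pos
        rw [← Nat.succ_mul, Nat.succ_eq_add_one, Nat.sub_add_cancel this]
        exact dvd_mul_right _ _
    · by_cases hpQ : p ∣ Q
      · exact ⟨0, fun _ => rfl, fun _ h => absurd hpQ h, fun h => absurd h hpW⟩
      · by_cases hpF : ∃ a ∈ F, p ∣ a
        · obtain ⟨a, ha, hpa⟩ := hpF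
          refine ⟨a, fun h => absurd h hpQ, fun hp _ b hb hpb => ?_, fun h => absurd h hpW⟩
          rw [h.eq_of_prime_dvd (n := 0) ha hb hp hpQ (by simpa) (by simpa)]
        · exact ⟨0, fun _ => rfl, fun _ _ a ha hpa => absurd ⟨a, ha, hpa⟩ hpF,
            fun h => absurd h hpW⟩
  choose c hc1 hc2 hc3 using hc
  have hne : ∀ p ∈ N.primeFactors ∪ W, p ^ (N.factorization p + 1) ≠ 0 := fun p hp =>
    pow_ne_zero _ (hTp p hp).ne_zero
  have hco : Set.Pairwise (N.primeFactors ∪ W : Finset ℕ)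
      (Function.onFun Nat.Coprime fun p => p ^ (N.factorization p + 1)) := fun p hp q hq hpq =>
    Nat.coprime_pow_primes _ _ (hTp p hp) (hTp q hq) hpq
  refine ⟨_, Nat.chineseRemainderOfFinset_lt_prod c _ hne hco, fun A hA => ?_⟩
  have hAc : ∀ p ∈ N.primeFactors ∪ W, A ≡ c p [MOD p ^ (N.factorization p + 1)] := fun p hp =>
    (hA.of_dvd (dvd_prod_of_mem _ hp)).trans
      ((Nat.chineseRemainderOfFinset c _ _ hne hco).2 p hp)
  refine ⟨fun p hp hpQ => ?_, fun p hp hpQ a ha hpa => ?_, fun p hp => ?_⟩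
  · exact (hAc p (mem_union_left _ (Nat.mem_primeFactors.2 ⟨hp, hpQ.mul_right _, hN⟩))).trans
      (hc1 p hpQ)
  · exact (hAc p (mem_union_left _ (Nat.mem_primeFactors.2 ⟨hp, hpa.trans (hFN a ha), hN⟩))).trans
      (hc2 p hp hpQ a ha hpa)
  · have h1 := (hAc p (mem_union_right _ hp)).of_dvd (dvd_pow_self p (Nat.succ_ne_zero _))
    exact ((h1.add_right (g p)).dvd_iff dvd_rfl).2 (hc3 p hp)

theorem BalancedFamily.exists_extension (h : BalancedFamily F Q) {n L k : ℕ} (hn : #F ≤ n)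
    (hQ : Q ≤ 2 ^ L) (hF : ∀ a ∈ F, a ≤ 2 ^ L) (hk : 3 ≤ k) (hkL : (n + 1) * ((n + 1) * L) ≤ 2 ^ k) :
    ∃ Q' r, Q' ≤ 2 ^ (2 * ((n + 1) * L) + 2 * k * (n * ((n + 1) * L))) ∧ (∀ a ∈ F, a ≤ Q') ∧
      r < Q' ∧ ∀ A, A ≠ 0 → A ≡ r [MOD Q'] →
        BalancedFamily (insert A (F.image (A + ·))) Q' := by
  have hN := h.mul_prod_ne_zero
  have hNL : Q * ∏ a ∈ F, a ≤ 2 ^ ((n + 1) * L) := by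
    calc Q * ∏ a ∈ F, a ≤ 2 ^ L * (2 ^ L) ^ #F := Nat.mul_le_mul hQ (prod_le_pow_card _ _ _ hF)
      _ ≤ 2 ^ L * (2 ^ L) ^ n := by gcongr; exact Nat.one_le_two_pow
      _ = 2 ^ ((n + 1) * L) := by rw [← pow_succ', ← pow_mul, mul_comm]
  have hP : #(Q * ∏ a ∈ F, a).primeFactors ≤ (n + 1) * L :=
    (Nat.pow_le_pow_iff_right (by norm_num)).1 ((two_pow_card_primeFactors_le hN).trans hNL)
  set s := ∑ a ∈ F, (#(Q * ∏ a ∈ F, a).primeFactors - #{p ∈ a.primeFactors | ¬ p ∣ Q}) with hs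
  have hsn : s ≤ n * ((n + 1) * L) := by
    calc s ≤ #F * ((n + 1) * L) := by
          rw [← smul_eq_mul]
          exact sum_le_card_nsmul _ _ _ fun a _ => (Nat.sub_le _ _).trans hP
      _ ≤ _ := Nat.mul_le_mul_right _ hn
  obtain ⟨W, hWs, hW⟩ := exists_primes_not_dvd (N := Q * ∏ a ∈ F, a) (n := s) hk (by
    rw [add_mul, one_mul] at hkL; omega)
  have hW' : ∀ q ∈ W, q.Prime ∧ ¬ q ∣ Q * ∏ a ∈ F, a := fun q hq =>
    ⟨(hW q hq).1, fun hd => (hW q hq).2.2 (Nat.mem_primeFactors.2 ⟨(hW q hq).1, hd, hN⟩)⟩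
  obtain ⟨g, hg, hgc⟩ := exists_fiber_card_eq F _ W hWs
  have hcard : ∀ a ∈ F, #{q ∈ W | g q = a} + #{p ∈ a.primeFactors | ¬ p ∣ Q} =
      #(Q * ∏ a ∈ F, a).primeFactors := by
    intro a ha
    rw [hgc a ha, Nat.sub_add_cancel]
    rw [← h.filter_dvd_eq ha]
    exact card_filter_le _ _
  obtain ⟨r, hr, hrA⟩ := h.exists_extensionCongruences (g := g) hW'
  have hTp : ∀ p ∈ (Q * ∏ a ∈ F, a).primeFactors ∪ W, p.Prime := by
    intro p hp
    rcases mem_union.1 hp with hp | hp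
    · exact Nat.prime_of_mem_primeFactors hp
    · exact (hW p hp).1
  have hQ'0 : (Q * ∏ a ∈ F, a) * ∏ p ∈ (Q * ∏ a ∈ F, a).primeFactors ∪ W, p ≠ 0 :=
    mul_ne_zero hN (prod_ne_zero_iff.2 fun p hp => (hTp p hp).ne_zero)
  refine ⟨_, r, ?_, fun a ha => ?_, hr, fun A hA0 hA => ?_⟩
  · have h1 : ∏ p ∈ (Q * ∏ a ∈ F, a).primeFactors ∪ W, p ≤
        (Q * ∏ a ∈ F, a) * (2 ^ (2 * k)) ^ s := by
      rw [prod_union (disjoint_left.2 fun p hp hpW => (hW p hpW).2.2 hp)]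
      refine Nat.mul_le_mul (Nat.le_of_dvd (by omega) (Nat.prod_primeFactors_dvd _)) ?_
      rw [← hWs]
      exact prod_le_pow_card _ _ _ fun q hq => (hW q hq).2.1
    calc _ ≤ 2 ^ ((n + 1) * L) * (2 ^ ((n + 1) * L) * (2 ^ (2 * k)) ^ (n * ((n + 1) * L))) := by
          refine Nat.mul_le_mul hNL (h1.trans (Nat.mul_le_mul hNL ?_))
          exact Nat.pow_le_pow_right (by positivity) hsn
      _ = _ := by rw [← pow_mul, ← pow_add, ← pow_add]; congr 1; ring
  · exact Nat.le_of_dvd (by omega) (((dvd_prod_of_mem _ ha).mul_left _).mul_right _)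
  · refine h.insert_translate (hrA A hA) hA0 hg hW' hcard hQ'0 (dvd_mul_right _ _) ?_
    rw [Nat.primeFactors_mul hN (right_ne_zero_of_mul hQ'0), Nat.primeFactors_prod hTp,
      ← union_assoc, union_self]

end Extension

theorem fourteen_mul_add_two_le_two_pow {m : ℕ} (hm : 7 ≤ m) : 14 * m + 2 ≤ 2 ^ m := by
  induction m, hm using Nat.le_induction with
  | base => norm_num
  | succ m hm ih => rw [pow_succ]; omega

theorem BalancedFamily.exists_extension_uniform {F : Finset ℕ} {Q : ℕ} (h : BalancedFamily F Q)
    {m n : ℕ} (hm : 7 ≤ m) (hn : n + 1 ≤ 2 ^ m) (hFn : #F = n) (hQ : Q ≤ 2 ^ 2 ^ (5 * m * n))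
    (hF : ∀ a ∈ F, a ≤ 2 ^ 2 ^ (5 * m * n)) :
    ∃ Q' r, Q' ≤ 2 ^ 2 ^ (5 * m * n + 4 * m) ∧ (∀ a ∈ F, a ≤ Q') ∧
      r < Q' ∧ ∀ A, A ≠ 0 → A ≡ r [MOD Q'] →
        BalancedFamily (insert A (F.image (A + ·))) Q' := by
  have hkL : (n + 1) * ((n + 1) * 2 ^ (5 * m * n)) ≤ 2 ^ (2 * m + 5 * m * n) := by
    calc _ ≤ 2 ^ m * (2 ^ m * 2 ^ (5 * m * n)) := by gcongr
      _ = _ := by rw [← pow_add, ← pow_add]; congr 1; ring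
  obtain ⟨Q', r, hQ', hrest⟩ := h.exists_extension hFn.le hQ hF (by omega) hkL
  refine ⟨Q', r, hQ'.trans (Nat.pow_le_pow_right (by norm_num) ?_), hrest⟩
  have h1 : 2 + 2 * (2 * m + 5 * m * n) ≤ 2 ^ m * 2 ^ m := by
    calc 2 + 2 * (2 * m + 5 * m * n) ≤ (14 * m + 2) * (n + 1) := by nlinarith
      _ ≤ _ := Nat.mul_le_mul (fourteen_mul_add_two_le_two_pow hm) hn
  calc 2 * ((n + 1) * 2 ^ (5 * m * n)) +
        2 * (2 * m + 5 * m * n) * (n * ((n + 1) * 2 ^ (5 * m * n)))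
      ≤ (2 + 2 * (2 * m + 5 * m * n)) * ((n + 1) * ((n + 1) * 2 ^ (5 * m * n))) := by
        generalize 2 ^ (5 * m * n) = L
        generalize 2 * (2 * m + 5 * m * n) = k
        have h2 : 0 ≤ n * ((n + 1) * L) := Nat.zero_le _
        have h3 : 0 ≤ k * ((n + 1) * L) := Nat.zero_le _
        nlinarith
    _ ≤ (2 ^ m * 2 ^ m) * 2 ^ (2 * m + 5 * m * n) := Nat.mul_le_mul h1 hkL
    _ = _ := by rw [← pow_add, ← pow_add]; congr 1; ring

theorem exists_balancedFamily {m : ℕ} (hm : 7 ≤ m) (n : ℕ) (hn : n ≤ 2 ^ m) :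
    ∃ F Q, BalancedFamily F Q ∧ #F = n ∧ Q ≤ 2 ^ 2 ^ (5 * m * n) ∧
      ∀ a ∈ F, a ≤ 2 ^ 2 ^ (5 * m * n) := by
  induction n with
  | zero => exact ⟨∅, 2, ⟨by norm_num, dvd_rfl, by simp, by simp, by simp, by simp⟩, by simp⟩
  | succ n ih =>
    obtain ⟨F, Q, h, hFn, hQ, hF⟩ := ih (by omega)
    obtain ⟨Q', r, hQ', hFQ', hr, hA⟩ := h.exists_extension_uniform hm hn hFn hQ hF
    have h1 : 2 ^ 2 ^ (5 * m * n + 4 * m) * 4 ≤ 2 ^ 2 ^ (5 * m * (n + 1)) := by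
      rw [show 2 ^ 2 ^ (5 * m * n + 4 * m) * 4 = 2 ^ (2 ^ (5 * m * n + 4 * m) + 2) by
        rw [pow_add _ _ 2, show (2 : ℕ) ^ 2 = 4 by norm_num]]
      refine Nat.pow_le_pow_right (by norm_num) ?_
      rw [show 5 * m * (n + 1) = 5 * m * n + 4 * m + m by ring, pow_add _ _ m]
      have h2 := Nat.one_lt_two_pow (n := 5 * m * n + 4 * m) (by omega)
      have h3 : 2 ≤ 2 ^ m := Nat.one_lt_two_pow (by omega)
      nlinarith
    refine ⟨_, Q', hA (r + Q') (by omega) (by simp [Nat.ModEq]), ?_, by omega, ?_⟩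
    · rw [card_insert_of_notMem, card_image_of_injective _ (add_right_injective _), hFn]
      simp only [mem_image, not_exists, not_and]
      intro a ha
      have := h.pos a ha
      omega
    · intro a ha
      simp only [mem_insert, mem_image] at ha
      rcases ha with rfl | ⟨a, ha, rfl⟩
      · omega
      · have := hFQ' a ha
        omega

theorem abs_card_dvd_sub_le {d Q : ℕ} (hd : d ≠ 0) (hdQ : d.Coprime Q) (c Y : ℕ) :
    |(#{y ∈ range Y | d ∣ c + Q * y} : ℝ) - Y / d| ≤ 1 := by
  have : NeZero d := ⟨hd⟩
  have hv : ∃ v, ∀ y, d ∣ c + Q * y ↔ y ≡ v [MOD d] := by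
    set u := ZMod.unitOfCoprime Q hdQ.symm with hu
    have huQ : (u : ZMod d) = Q := ZMod.coe_unitOfCoprime _ _
    refine ⟨((-c : ZMod d) * (u⁻¹ : (ZMod d)ˣ)).val, fun y => ?_⟩
    rw [← ZMod.natCast_eq_zero_iff, ← ZMod.natCast_eq_natCast_iff, ZMod.natCast_zmod_val,
      Units.eq_mul_inv_iff_mul_eq, huQ]
    push_cast
    constructor <;> intro h <;> linear_combination h
  obtain ⟨v, hv⟩ := hv
  simp_rw [hv]
  rw [← Nat.count_eq_card_filter_range, Nat.count_modEq_card _ (by omega)]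
  have h1 : (Y : ℝ) / d = (Y / d : ℕ) + (Y % d : ℕ) / (d : ℝ) := by
    have hd' : (d : ℝ) ≠ 0 := by exact_mod_cast hd
    field_simp
    exact_mod_cast (Nat.div_add_mod Y d).symm
  have h2 : ((Y % d : ℕ) : ℝ) / d ≤ 1 := by
    rw [div_le_one (by positivity)]
    exact_mod_cast (Nat.mod_lt Y (by omega)).le
  have h3 : 0 ≤ ((Y % d : ℕ) : ℝ) / d := by positivity
  rw [h1, abs_le]
  push_cast
  split_ifs <;> constructor <;> linarith

theorem sum_mul_indicator_sub_le {P : Finset ℕ} {Q : ℕ} (hP : ∀ p ∈ P, p.Prime ∧ ¬ p ∣ Q)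
    (c Y : ℕ) {p q : ℕ} (hp : p ∈ P) (hq : q ∈ P) :
    ∑ y ∈ range Y, ((if p ∣ c + Q * y then 1 else 0) - 1 / (p : ℝ)) *
      ((if q ∣ c + Q * y then 1 else 0) - 1 / (q : ℝ)) ≤ 2 + if p = q then Y / (p : ℝ) else 0 := by
  have hcop : ∀ p ∈ P, p.Coprime Q := fun p hp => (hP p hp).1.coprime_iff_not_dvd.2 (hP p hp).2
  have hexp : ∑ y ∈ range Y, ((if p ∣ c + Q * y then 1 else 0) - 1 / (p : ℝ)) *
      ((if q ∣ c + Q * y then 1 else 0) - 1 / (q : ℝ)) =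
      (#{y ∈ range Y | p ∣ c + Q * y ∧ q ∣ c + Q * y} : ℝ) -
        #{y ∈ range Y | p ∣ c + Q * y} / q - #{y ∈ range Y | q ∣ c + Q * y} / p + Y / (p * q) := by
    simp only [card_filter, Nat.cast_sum, sum_div]
    have : (Y : ℝ) / (p * q) = ∑ y ∈ range Y, 1 / ((p : ℝ) * q) := by
      rw [sum_const, card_range, nsmul_eq_mul]; ring
    rw [this, ← sum_sub_distrib, ← sum_sub_distrib, ← sum_add_distrib]
    refine sum_congr rfl fun y _ => ?_
    by_cases h1 : p ∣ c + Q * y <;> by_cases h2 : q ∣ c + Q * y <;> simp [h1, h2] <;> ring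
  have hp2 : (2 : ℝ) ≤ p := by exact_mod_cast (hP p hp).1.two_le
  have hq2 : (2 : ℝ) ≤ q := by exact_mod_cast (hP q hq).1.two_le
  have hNp := abs_le.1 (abs_card_dvd_sub_le (hP p hp).1.ne_zero (hcop p hp) c Y)
  have hNq := abs_le.1 (abs_card_dvd_sub_le (hP q hq).1.ne_zero (hcop q hq) c Y)
  have hpi : (p : ℝ)⁻¹ ≤ 2⁻¹ := inv_anti₀ (by norm_num) hp2
  have hqi : (q : ℝ)⁻¹ ≤ 2⁻¹ := inv_anti₀ (by norm_num) hq2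
  have hpi0 : 0 ≤ (p : ℝ)⁻¹ := by positivity
  have hqi0 : 0 ≤ (q : ℝ)⁻¹ := by positivity
  have hY0 : (0 : ℝ) ≤ Y := by positivity
  rw [hexp]
  by_cases hpq : p = q
  · subst hpq
    simp only [and_self, if_true, div_eq_mul_inv, mul_inv] at *
    generalize (p : ℝ)⁻¹ = x at *
    generalize (#{y ∈ range Y | p ∣ c + Q * y} : ℝ) = N at *
    nlinarith [mul_nonneg hY0 (mul_nonneg hpi0 hpi0),
      mul_nonneg (sub_nonneg.2 hNp.2) (by linarith : 0 ≤ 1 - 2 * x)]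
  · have hpq' : Nat.Coprime p q := (Nat.coprime_primes (hP p hp).1 (hP q hq).1).2 hpq
    have hNpq := (abs_le.1 (abs_card_dvd_sub_le (mul_ne_zero (hP p hp).1.ne_zero
      (hP q hq).1.ne_zero) (Nat.Coprime.mul_left (hcop p hp) (hcop q hq)) c Y)).2
    have hmul : ∀ N, p * q ∣ N ↔ p ∣ N ∧ q ∣ N := fun N =>
      ⟨fun h => ⟨dvd_of_mul_right_dvd h, dvd_of_mul_left_dvd h⟩,
        fun h => hpq'.mul_dvd_of_dvd_of_dvd h.1 h.2⟩
    simp_rw [hmul] at hNpq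
    simp only [hpq, if_false, div_eq_mul_inv, mul_inv, Nat.cast_mul] at *
    generalize (p : ℝ)⁻¹ = x at *
    generalize (q : ℝ)⁻¹ = z at *
    nlinarith [mul_nonneg (neg_le_iff_add_nonneg.1 hNp.1) hqi0,
      mul_nonneg (neg_le_iff_add_nonneg.1 hNq.1) hpi0]

/-- The Turán–Kubilius inequality along the progression `c + Q * y`. -/
theorem sum_sq_card_dvd_sub_le {P : Finset ℕ} {Q : ℕ} (hP : ∀ p ∈ P, p.Prime ∧ ¬ p ∣ Q)
    (c Y : ℕ) (hY : #P ^ 2 ≤ Y) :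
    ∑ y ∈ range Y, ((#{p ∈ P | p ∣ c + Q * y} : ℝ) - ∑ p ∈ P, 1 / (p : ℝ)) ^ 2 ≤
      Y * (∑ p ∈ P, 1 / (p : ℝ) + 2) := by
  have h1 : ∀ y, ((#{p ∈ P | p ∣ c + Q * y} : ℝ) - ∑ p ∈ P, 1 / (p : ℝ)) ^ 2 =
      ∑ p ∈ P, ∑ q ∈ P, ((if p ∣ c + Q * y then 1 else 0) - 1 / (p : ℝ)) *
      ((if q ∣ c + Q * y then 1 else 0) - 1 / (q : ℝ)) := by
    intro y
    rw [← sum_mul_sum, ← sq, sum_sub_distrib, card_filter]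
    push_cast
    rfl
  simp_rw [h1]
  rw [sum_comm]
  simp_rw [sum_comm (s := range Y)]
  calc _ ≤ ∑ p ∈ P, ∑ q ∈ P, ((2 : ℝ) + if p = q then Y / (p : ℝ) else 0) :=
        sum_le_sum fun p hp => sum_le_sum fun q hq => sum_mul_indicator_sub_le hP c Y hp hq
    _ = 2 * (#P : ℝ) ^ 2 + Y * ∑ p ∈ P, 1 / (p : ℝ) := by
        simp_rw [sum_add_distrib, sum_ite_eq, sum_const, nsmul_eq_mul, mul_sum]
        rw [sum_ite_mem, inter_self]
        congr 1
        · ring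
        · exact sum_congr rfl fun p _ => by ring
    _ ≤ _ := by
        have : (#P : ℝ) ^ 2 ≤ Y := by exact_mod_cast hY
        linarith

theorem sum_one_div_primes_dyadic_le {K : ℕ} (hK : 1 ≤ K) :
    ∑ p ∈ Nat.primesLE (2 ^ (K + 1)) \ Nat.primesLE (2 ^ K), 1 / (p : ℝ) ≤ 4 / K := by
  set D := Nat.primesLE (2 ^ (K + 1)) \ Nat.primesLE (2 ^ K) with hD
  have hlt : ∀ p ∈ D, 2 ^ K ≤ p := by
    intro p hp
    simp only [hD, mem_sdiff, Nat.mem_primesLE, not_and] at hp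
    by_contra! hlt
    exact hp.2 hlt.le hp.1.2
  have h1 : (2 ^ K) ^ #D ≤ 4 ^ 2 ^ (K + 1) := by
    refine (pow_card_le_prod _ _ _ hlt).trans (le_trans ?_ (primorial_le_four_pow _))
    exact prod_le_prod_of_subset_of_one_le' sdiff_subset
      fun p hp _ => (Nat.prime_of_mem_primesLE hp).one_le
  have h2 : K * #D ≤ 4 * 2 ^ K := by
    rw [show 4 = 2 ^ 2 by norm_num, ← pow_mul, ← pow_mul,
      Nat.pow_le_pow_iff_right (by norm_num)] at h1
    rw [pow_succ] at h1
    omega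
  calc ∑ p ∈ D, 1 / (p : ℝ) ≤ ∑ p ∈ D, 1 / (2 : ℝ) ^ K := by
        refine sum_le_sum fun p hp => one_div_le_one_div_of_le (by positivity) ?_
        exact_mod_cast hlt p hp
    _ = #D / (2 : ℝ) ^ K := by rw [sum_const, nsmul_eq_mul]; ring
    _ ≤ 4 / K := by
        rw [div_le_div_iff₀ (by positivity) (by positivity)]
        have : (K : ℝ) * #D ≤ 4 * 2 ^ K := by exact_mod_cast h2
        linarith

theorem sum_one_div_primes_le_harmonic (K : ℕ) :
    ∑ p ∈ Nat.primesLE (2 ^ (K + 1)), 1 / (p : ℝ) ≤ 1 + 4 * (harmonic K : ℝ) := by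
  induction K with
  | zero =>
    have : Nat.primesLE (2 ^ (0 + 1)) = {2} := by decide
    rw [this]
    norm_num
  | succ K ih =>
    have hsub : Nat.primesLE (2 ^ (K + 1)) ⊆ Nat.primesLE (2 ^ (K + 1 + 1)) := fun p hp => by
      rw [Nat.mem_primesLE] at *
      exact ⟨hp.1.trans (Nat.pow_le_pow_right (by norm_num) (by omega)), hp.2⟩
    rw [← sum_sdiff hsub, harmonic_succ]
    have := sum_one_div_primes_dyadic_le (K := K + 1) (by omega)
    push_cast at *
    rw [div_eq_mul_inv] at this
    linarith

theorem sum_one_div_primes_le (J : ℕ) :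
    ∑ p ∈ Nat.primesLE (2 ^ 2 ^ J), 1 / (p : ℝ) ≤ 5 + 4 * J := by
  have h1 := sum_one_div_primes_le_harmonic (2 ^ J - 1)
  have hpos := Nat.one_le_two_pow (n := J)
  rw [Nat.sub_add_cancel hpos] at h1
  have h2 := harmonic_le_one_add_log (2 ^ J - 1)
  have h3 : Real.log ((2 ^ J - 1 : ℕ) : ℝ) ≤ J := by
    rcases Nat.eq_zero_or_pos (2 ^ J - 1) with h0 | h0
    · rw [h0]; simp
    · calc Real.log ((2 ^ J - 1 : ℕ) : ℝ) ≤ Real.log (2 ^ J) := by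
            refine Real.log_le_log (by exact_mod_cast h0) ?_
            exact_mod_cast Nat.sub_le _ _
        _ = J * Real.log 2 := Real.log_pow _ _
        _ ≤ J * 1 := by gcongr; linarith [Real.log_two_lt_d9]
        _ = J := mul_one _
  linarith

theorem card_le_of_injOn_of_abs_sub_le {G : Finset ℕ} {f : ℕ → ℕ} (hf : Set.InjOn f G) {x : ℝ}
    {R : ℕ} (hR : ∀ a ∈ G, |(f a : ℝ) - x| ≤ R) : #G ≤ 2 * R + 1 := by
  have h1 : #G ≤ #(Icc ⌈x - R⌉ ⌊x + R⌋) := by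
    refine card_le_card_of_injOn (fun a => (f a : ℤ)) (fun a ha => ?_)
      fun a ha b hb hab => hf ha hb (Int.natCast_inj.1 hab)
    have := abs_le.1 (hR a ha)
    simp only [coe_Icc, Set.mem_Icc, Int.ceil_le, Int.le_floor, Int.cast_natCast]
    constructor <;> linarith
  rw [Int.card_Icc, Int.floor_add_natCast, Int.ceil_sub_natCast] at h1
  have := Int.floor_le_ceil x
  omega

theorem pow_three_le_sum_sq_of_injOn {F : Finset ℕ} {f : ℕ → ℕ} (hf : Set.InjOn f F) {k : ℕ}
    (hk : 2 ≤ k) (hF : #F + 1 = 4 * k) (x : ℝ) : (k : ℝ) ^ 3 ≤ ∑ a ∈ F, ((f a : ℝ) - x) ^ 2 := by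
  have h1 := card_le_of_injOn_of_abs_sub_le (G := {a ∈ F | |(f a : ℝ) - x| ≤ k})
    (hf.mono fun a ha => (mem_filter.1 ha).1) (fun a ha => (mem_filter.1 ha).2)
  have h2 := card_filter_add_card_filter_not (s := F) fun a => |(f a : ℝ) - x| ≤ k
  have h3 : k ≤ #{a ∈ F | ¬ |(f a : ℝ) - x| ≤ k} := by omega
  calc (k : ℝ) ^ 3 = k * (k : ℝ) ^ 2 := by ring
    _ ≤ #{a ∈ F | ¬ |(f a : ℝ) - x| ≤ k} * (k : ℝ) ^ 2 := by gcongr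
    _ = ∑ a ∈ F with ¬ |(f a : ℝ) - x| ≤ k, (k : ℝ) ^ 2 := by rw [sum_const, nsmul_eq_mul]
    _ ≤ ∑ a ∈ F with ¬ |(f a : ℝ) - x| ≤ k, ((f a : ℝ) - x) ^ 2 := by
        refine sum_le_sum fun a ha => ?_
        rw [← sq_abs ((f a : ℝ) - x)]
        have := (mem_filter.1 ha).2
        gcongr
        linarith
    _ ≤ _ := sum_le_sum_of_subset_of_nonneg (filter_subset _ _) fun _ _ _ => sq_nonneg _

theorem exists_sum_sq_card_dvd_sub_le {P : Finset ℕ} {Q : ℕ} (hP : ∀ p ∈ P, p.Prime ∧ ¬ p ∣ Q)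
    (F : Finset ℕ) (c : ℕ) {Y : ℕ} (hY : #P ^ 2 ≤ Y) (hY0 : Y ≠ 0) :
    ∃ y < Y, ∑ a ∈ F, ((#{p ∈ P | p ∣ c + a + Q * y} : ℝ) - ∑ p ∈ P, 1 / (p : ℝ)) ^ 2 ≤
      #F * (∑ p ∈ P, 1 / (p : ℝ) + 2) := by
  have h1 := sum_le_sum fun a (_ : a ∈ F) => sum_sq_card_dvd_sub_le hP (c + a) Y hY
  rw [sum_comm, sum_const, nsmul_eq_mul] at h1
  obtain ⟨y, hy, h⟩ := exists_le_of_sum_le (s := range Y) (nonempty_range_iff.2 hY0)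
    (g := fun _ => #F * (∑ p ∈ P, 1 / (p : ℝ) + 2)) (h1.trans_eq (by
      rw [sum_const, card_range, nsmul_eq_mul]; ring))
  exact ⟨y, mem_range.1 hy, h⟩

theorem card_primeFactors_not_dvd_le {N Z Q k : ℕ} (hN : N ≠ 0) (hZ : 1 < Z)
    (hNZ : N < Z ^ (k + 1)) :
    #{p ∈ N.primeFactors | ¬ p ∣ Q} ≤
      #{p ∈ {p ∈ Nat.primesLE Z | ¬ p ∣ Q} | p ∣ N} + k := by
  have hlarge : #{p ∈ N.primeFactors | Z < p} ≤ k := by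
    have h1 : Z ^ #{p ∈ N.primeFactors | Z < p} ≤ ∏ p ∈ N.primeFactors with Z < p, p :=
      pow_card_le_prod _ _ _ fun p hp => (mem_filter.1 hp).2.le
    have h2 : ∏ p ∈ N.primeFactors with Z < p, p ≤ ∏ p ∈ N.primeFactors, p :=
      prod_le_prod_of_subset_of_one_le' (filter_subset _ _)
        fun p hp _ => (Nat.prime_of_mem_primeFactors hp).one_le
    have h3 := Nat.le_of_dvd (Nat.pos_of_ne_zero hN) (Nat.prod_primeFactors_dvd N)
    have := (Nat.pow_lt_pow_iff_right hZ).1 (((h1.trans h2).trans h3).trans_lt hNZ)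
    omega
  refine le_trans (card_le_card ?_) ((card_union_le _ _).trans (Nat.add_le_add_left hlarge _))
  intro p hp
  simp only [mem_union, mem_filter, Nat.mem_primesLE, Nat.mem_primeFactors] at *
  rcases le_or_gt p Z with h | h
  · exact Or.inl ⟨⟨⟨h, hp.1.1⟩, hp.2⟩, hp.1.2.1⟩
  · exact Or.inr ⟨hp.1, h⟩

theorem card_primesLE_dvd_le {N : ℕ} (hN : N ≠ 0) (Z Q : ℕ) :
    #{p ∈ {p ∈ Nat.primesLE Z | ¬ p ∣ Q} | p ∣ N} ≤ #{p ∈ N.primeFactors | ¬ p ∣ Q} := by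
  refine card_le_card fun p hp => ?_
  simp only [mem_filter, Nat.mem_primesLE, Nat.mem_primeFactors] at *
  exact ⟨⟨hp.1.1.2, hp.2, hN⟩, hp.1.2⟩

theorem mul_add_lt_two_pow_add {m : ℕ} (hm : 14 ≤ m) : 640 * (m + 2) + 184 < 2 ^ m := by
  induction m, hm using Nat.le_induction with
  | base => norm_num
  | succ m hm ih => rw [pow_succ]; omega

/-- If `F` is large and all its members are at most `Q`, then some translate of `F` by a number
congruent to `c` modulo `Q` has two members with equally many prime factors not dividing `Q`. -/
theorem exists_translate_card_primeFactors_eq {F : Finset ℕ} {Q Z m c : ℕ} (hm : 14 ≤ m)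
    (hF : #F + 1 = 4 * 2 ^ m) (hZ : Z = 2 ^ 2 ^ (5 * (m + 2) * 2 ^ (m + 2))) (hQZ : Q ≤ Z)
    (hFZ : ∀ a ∈ F, a ≤ Z) (hc : c ≠ 0) (hcZ : c ≤ Z ^ 2) :
    ∃ y, ∃ a ∈ F, ∃ b ∈ F, a < b ∧
      #{p ∈ (c + a + Q * y).primeFactors | ¬ p ∣ Q} =
        #{p ∈ (c + b + Q * y).primeFactors | ¬ p ∣ Q} := by
  set P := {p ∈ Nat.primesLE Z | ¬ p ∣ Q} with hPdef
  set x := ∑ p ∈ P, 1 / (p : ℝ) with hx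
  have hP : ∀ p ∈ P, p.Prime ∧ ¬ p ∣ Q := fun p hp => by
    simp only [hPdef, mem_filter, Nat.mem_primesLE] at hp
    exact ⟨hp.1.2, hp.2⟩
  have hZ4 : 4 ≤ Z := by
    rw [hZ, show 4 = 2 ^ 2 ^ 1 by norm_num]
    refine Nat.pow_le_pow_right (by norm_num) (Nat.pow_le_pow_right (by norm_num) ?_)
    exact Nat.mul_pos (by omega) (by positivity)
  have hPZ : #P ^ 2 ≤ Z ^ 2 := by
    refine Nat.pow_le_pow_left ?_ 2
    calc #P ≤ #(Ioc 0 Z) := card_le_card fun p hp => by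
          simp only [hPdef, mem_filter, Nat.mem_primesLE] at hp
          exact mem_Ioc.2 ⟨hp.1.2.pos, hp.1.1⟩
      _ = Z := by simp
  obtain ⟨y, hy, hsum⟩ := exists_sum_sq_card_dvd_sub_le hP F c hPZ (by positivity)
  refine ⟨y, ?_⟩
  by_contra! hne
  set f : ℕ → ℕ := fun a => #{p ∈ (c + a + Q * y).primeFactors | ¬ p ∣ Q} with hf
  have hinj : Set.InjOn f F := by
    intro a ha b hb hab
    rcases lt_trichotomy a b with h | h | h
    · exact absurd hab (hne a ha b hb h)
    · exact h
    · exact absurd hab.symm (hne b hb a ha h)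
  have hlow := pow_three_le_sum_sq_of_injOn hinj (k := 2 ^ m) (Nat.one_lt_two_pow (by omega)) hF x
  have hterm : ∀ a ∈ F, ((f a : ℝ) - x) ^ 2 ≤
      2 * ((#{p ∈ P | p ∣ c + a + Q * y} : ℝ) - x) ^ 2 + 32 := by
    intro a ha
    have hN : c + a + Q * y ≠ 0 := by omega
    have hNZ : c + a + Q * y < Z ^ (4 + 1) := by
      have h1 : Q * y ≤ Z * Z ^ 2 := Nat.mul_le_mul hQZ hy.le
      have h2 := hFZ a ha
      calc c + a + Q * y ≤ Z ^ 2 + Z + Z * Z ^ 2 := by omega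
        _ < 4 * Z ^ 3 := by nlinarith
        _ ≤ Z * Z ^ 3 := by gcongr
        _ ≤ Z * Z ^ 3 * Z := Nat.le_mul_of_pos_right _ (by omega)
        _ = _ := by ring
    have h1 : (f a : ℝ) ≤ #{p ∈ P | p ∣ c + a + Q * y} + 4 := by
      exact_mod_cast card_primeFactors_not_dvd_le (Q := Q) hN (by omega : 1 < Z) hNZ
    have h2 : (#{p ∈ P | p ∣ c + a + Q * y} : ℝ) ≤ f a := by
      exact_mod_cast card_primesLE_dvd_le hN Z Q
    generalize (#{p ∈ P | p ∣ c + a + Q * y} : ℝ) = w at *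
    nlinarith [sq_nonneg (w - x - (f a - w))]
  have hx_le : x ≤ 5 + 4 * (5 * (m + 2) * (4 * 2 ^ m)) := by
    have h1 := sum_one_div_primes_le (5 * (m + 2) * 2 ^ (m + 2))
    rw [← hZ] at h1
    have h2 : x ≤ ∑ p ∈ Nat.primesLE Z, 1 / (p : ℝ) :=
      sum_le_sum_of_subset_of_nonneg (filter_subset _ _) fun _ _ _ => by positivity
    push_cast [pow_add] at h1
    linarith
  have hup := hlow.trans (sum_le_sum hterm)
  rw [sum_add_distrib, ← mul_sum, sum_const, nsmul_eq_mul] at hup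
  have hFr : (#F : ℝ) + 1 = 4 * 2 ^ m := by exact_mod_cast hF
  have hmr : (640 : ℝ) * (m + 2) + 184 < 2 ^ m := by exact_mod_cast mul_add_lt_two_pow_add hm
  push_cast at hup
  have hx0 : 0 ≤ x := sum_nonneg fun _ _ => by positivity
  have hk1 : (1 : ℝ) ≤ 2 ^ m := one_le_pow₀ (by norm_num)
  generalize (2 : ℝ) ^ m = k at *
  have h1 : k ^ 3 ≤ 4 * k * (2 * x + 36) := by nlinarith
  have h2 : k * k ^ 2 ≤ k * (184 + 640 * (m + 2) * k) := by nlinarith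
  have h3 := le_of_mul_le_mul_left h2 (by linarith)
  nlinarith

theorem exists_card_primeFactors_eq_succ (t : ℕ) :
    ∃ n > t, #n.primeFactors = #(n + 1).primeFactors := by
  obtain ⟨m, hm, htm⟩ : ∃ m, 14 ≤ m ∧ t ≤ m := ⟨max 14 t, le_max_left _ _, le_max_right _ _⟩
  have hpos : 0 < 2 ^ (m + 2) := by positivity
  obtain ⟨F, Q, h, hFn, hQ, hF⟩ :=
    exists_balancedFamily (m := m + 2) (by omega) (2 ^ (m + 2) - 1) (Nat.sub_le _ _)
  obtain ⟨Q', r, hQ', hFQ', hr, hA⟩ :=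
    h.exists_extension_uniform (by omega) (by omega) hFn hQ hF
  obtain ⟨Z, hZ⟩ : ∃ Z, Z = 2 ^ 2 ^ (5 * (m + 2) * 2 ^ (m + 2)) := ⟨_, rfl⟩
  have hQZ : Q' ≤ Z := by
    rw [hZ]
    refine hQ'.trans (Nat.pow_le_pow_right (by norm_num) (Nat.pow_le_pow_right (by norm_num) ?_))
    obtain ⟨n, hn⟩ : ∃ n, 2 ^ (m + 2) = n + 1 := ⟨_, (Nat.sub_add_cancel hpos).symm⟩
    rw [hn, Nat.add_sub_cancel]
    nlinarith
  have hmZ : m + 2 ≤ Z := by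
    rw [hZ]
    have h1 : m + 2 ≤ 5 * (m + 2) * 2 ^ (m + 2) := by nlinarith
    exact h1.trans (Nat.lt_two_pow_self.trans Nat.lt_two_pow_self).le
  have hc0 : r + Q' * (t + 1) ≠ 0 := by
    have : 0 < Q' * (t + 1) := Nat.mul_pos (by omega) (Nat.succ_pos t)
    omega
  obtain ⟨y, a, ha, b, hb, hab, heq⟩ := exists_translate_card_primeFactors_eq hm
    (by rw [hFn, Nat.sub_add_cancel hpos, pow_add]; ring) hZ hQZ
    (fun a ha => (hFQ' a ha).trans hQZ) hc0
    (by nlinarith : r + Q' * (t + 1) ≤ Z ^ 2)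
  have hfam := hA (r + Q' * (t + 1) + Q' * y) (by omega) (by simp [Nat.ModEq, add_assoc, ← mul_add])
  have hmem : ∀ a ∈ F, r + Q' * (t + 1) + a + Q' * y ∈
      insert (r + Q' * (t + 1) + Q' * y) (F.image (r + Q' * (t + 1) + Q' * y + ·)) :=
    fun a ha => mem_insert_of_mem (mem_image.2 ⟨a, ha, by ring⟩)
  refine ⟨_, ?_, hfam.card_primeFactors_eq (hmem a ha) (hmem b hb) (by omega) heq⟩
  have hbQ := hFQ' b hb
  rw [gt_iff_lt, Nat.lt_iff_add_one_le, Nat.le_div_iff_mul_le (by omega)]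
  calc (t + 1) * _ ≤ (t + 1) * Q' := Nat.mul_le_mul_left _ (by omega)
    _ = Q' * (t + 1) := mul_comm _ _
    _ ≤ _ := by omega

/-- There are infinitely many positive integers `n` such that `n` and `n+1` have the
same number of distinct prime factors, i.e. `ω(n) = ω(n+1)`. -/
theorem infinitely_many_omega_eq_omega_succ :
    {n : ℕ | 0 < n ∧ n.primeFactors.card = (n + 1).primeFactors.card}.Infinite := by
  refine Set.infinite_of_forall_exists_gt fun t => ?_
  obtain ⟨n, hn, h⟩ := exists_card_primeFactors_eq_succ t
  exact ⟨n, ⟨by omega, h⟩, hn⟩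
end

section
/- Suppose $a_1, a_2, a_3, a_4, a_5$ are distinct positive integers such that for every pair $1 \leq i < j \leq 5$ one has $\gcd(a_i, a_j) = |a_i - a_j|$ and $\omega\left(\frac{a_i}{|a_i - a_j|}\right) = \omega\left(\frac{a_j}{|a_i - a_j|}\right)$. Let $A = a_1 a_2 a_3 a_4 a_5$, and suppose further that there are infinitely many positive integers $n$ with $\sum_{i=1}^{5} 2^{\omega(a_i A n + 1)} \leq 57$. Then there are infinitely many positive integers $m$ such that $\omega(m) = \omega(m+1)$. -/
/-- Five powers `2 ^ f i` with distinct positive exponents sum to at least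
`2 + 4 + 8 + 16 + 32 = 62`, so a sum at most `57` forces two exponents to agree. -/
theorem exists_lt_eq_of_sum_two_pow_le (f : Fin 5 → ℕ) (hf : ∀ i, 1 ≤ f i)
    (hsum : ∑ i, 2 ^ f i ≤ 57) : ∃ i j, i < j ∧ f i = f j := by
  by_contra! hne
  have hinj : Function.Injective f := by
    intro i j hij
    rcases lt_trichotomy i j with h | h | h
    · exact absurd hij (hne i j h)
    · exact h
    · exact absurd hij.symm (hne j i h)
  have hsub : Finset.univ.image f ⊆ Finset.Icc 1 5 := by
    intro k hk
    obtain ⟨i, -, rfl⟩ := Finset.mem_image.1 hk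
    refine Finset.mem_Icc.2 ⟨hf i, ?_⟩
    by_contra! h
    have h₁ : 2 ^ f i ≤ ∑ i, 2 ^ f i :=
      Finset.single_le_sum (f := fun i => 2 ^ f i) (fun _ _ => Nat.zero_le _) (Finset.mem_univ i)
    have h₂ : 2 ^ 6 ≤ 2 ^ f i := Nat.pow_le_pow_right two_pos h
    omega
  have himage : Finset.univ.image f = Finset.Icc 1 5 :=
    Finset.eq_of_subset_of_card_le hsub (by simp [Finset.card_image_of_injective _ hinj])
  have htotal : ∑ k ∈ Finset.univ.image f, 2 ^ k = ∑ i, 2 ^ f i :=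
    Finset.sum_image hinj.injOn
  have hval : ∑ k ∈ Finset.Icc 1 5, 2 ^ k = 62 := by decide
  rw [himage, hval] at htotal
  omega

/-- The number of distinct prime divisors is additive on coprime products. -/
theorem card_primeFactors_mul_of_coprime {m n : ℕ} (h : m.Coprime n) :
    (m * n).primeFactors.card = m.primeFactors.card + n.primeFactors.card := by
  rw [h.primeFactors_mul, Finset.card_union_of_disjoint h.disjoint_primeFactors]

/-- If `x < y` satisfy `y - x ∣ x`, and `ω` agrees on `x / (y - x)`, `y / (y - x)` and on
`x * N + 1`, `y * N + 1`, then the consecutive integers `x / (y - x) * (y * N + 1)` and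
`y / (y - x) * (x * N + 1)` have the same `ω`, provided `x` and `y` divide `N`. -/
theorem exists_gt_card_primeFactors_eq_succ {x y N : ℕ} (hx : 0 < x) (hxy : x < y)
    (hdvd : y - x ∣ x) (hxN : x ∣ N) (hyN : y ∣ N)
    (hquot : (x / (y - x)).primeFactors.card = (y / (y - x)).primeFactors.card)
    (hlin : (x * N + 1).primeFactors.card = (y * N + 1).primeFactors.card) :
    ∃ m, N < m ∧ m.primeFactors.card = (m + 1).primeFactors.card := by
  obtain ⟨d, rfl⟩ := Nat.exists_eq_add_of_lt hxy
  rw [show x + d + 1 - x = d + 1 by omega] at hdvd hquot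
  obtain ⟨u, rfl⟩ := hdvd
  have hy : (d + 1) * u + d + 1 = (d + 1) * (u + 1) := by ring
  rw [hy] at hquot hlin hyN
  rw [Nat.mul_div_cancel_left _ d.succ_pos, Nat.mul_div_cancel_left _ d.succ_pos] at hquot
  have hu : 0 < u := Nat.pos_of_mul_pos_left hx
  have hcop : ∀ {w z : ℕ}, w ∣ N → Nat.Coprime w (z * N + 1) := by
    rintro w z ⟨k, rfl⟩
    rw [show z * (w * k) + 1 = 1 + w * (z * k) by ring]
    simp
  refine ⟨u * ((d + 1) * (u + 1) * N + 1), ?_, ?_⟩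
  · have h₁ : 1 * N ≤ (d + 1) * (u + 1) * N := Nat.mul_le_mul_right _ (Nat.mul_pos d.succ_pos u.succ_pos)
    have h₂ := Nat.mul_le_mul_right ((d + 1) * (u + 1) * N + 1) hu
    simp only [Nat.succ_eq_add_one, zero_add] at h₂
    omega
  · rw [show u * ((d + 1) * (u + 1) * N + 1) + 1 = (u + 1) * ((d + 1) * u * N + 1) by ring,
      card_primeFactors_mul_of_coprime (hcop ((dvd_mul_left _ _).trans hxN)),
      card_primeFactors_mul_of_coprime (hcop ((dvd_mul_left _ _).trans hyN)), hquot, hlin]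

/-- Suppose `a 0, …, a 4` are distinct positive integers such that for every pair `i < j`
one has `gcd(a i, a j) = |a i - a j|` and `ω(a i / |a i - a j|) = ω(a j / |a i - a j|)`.
Let `A = ∏ i, a i`, and suppose there are infinitely many positive integers `n` with
`∑ i, 2 ^ ω(a i * A * n + 1) ≤ 57`. Then there are infinitely many positive integers `m`
with `ω(m) = ω(m + 1)`. -/
theorem infinitely_many_omega_eq_of_special_quintuple (a : Fin 5 → ℕ)
    (hpos : ∀ i, 0 < a i) (hdist : Function.Injective a)
    (hgcd : ∀ i j, i < j → Nat.gcd (a i) (a j) = ((a i : ℤ) - (a j : ℤ)).natAbs)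
    (homega : ∀ i j, i < j →
      (a i / ((a i : ℤ) - (a j : ℤ)).natAbs).primeFactors.card =
        (a j / ((a i : ℤ) - (a j : ℤ)).natAbs).primeFactors.card)
    (A : ℕ) (hA : A = ∏ i, a i)
    (hinf : {n : ℕ | 0 < n ∧ ∑ i, 2 ^ (a i * A * n + 1).primeFactors.card ≤ 57}.Infinite) :
    {m : ℕ | 0 < m ∧ m.primeFactors.card = (m + 1).primeFactors.card}.Infinite := by
  have hApos : 0 < A := hA ▸ Finset.prod_pos fun i _ => hpos i
  have hdvdA : ∀ i, a i ∣ A := fun i => hA ▸ Finset.dvd_prod_of_mem a (Finset.mem_univ i)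
  refine Set.infinite_of_forall_exists_gt fun b => ?_
  obtain ⟨n, ⟨hn, hsum⟩, hbn⟩ := hinf.exists_gt b
  have hnA : n ≤ A * n := Nat.le_mul_of_pos_left n hApos
  have hdvd : ∀ i, a i ∣ A * n := fun i => (hdvdA i).mul_right n
  simp only [mul_assoc] at hsum
  obtain ⟨i, j, hij, hω⟩ := exists_lt_eq_of_sum_two_pow_le
    (fun i => (a i * (A * n) + 1).primeFactors.card)
    (fun i => Finset.card_pos.2 <| Nat.nonempty_primeFactors.2 <| by
      have := Nat.mul_pos (hpos i) (Nat.mul_pos hApos hn)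
      omega) hsum
  have hg := hgcd i j hij
  have hq := homega i j hij
  suffices ∃ m, A * n < m ∧ m.primeFactors.card = (m + 1).primeFactors.card by
    obtain ⟨m, hm, h⟩ := this
    exact ⟨m, ⟨by omega, h⟩, by omega⟩
  rcases lt_or_gt_of_ne (hdist.ne hij.ne) with hlt | hlt
  · rw [show ((a i : ℤ) - (a j : ℤ)).natAbs = a j - a i by omega] at hg hq
    exact exists_gt_card_primeFactors_eq_succ (hpos i) hlt (hg ▸ Nat.gcd_dvd_left _ _)
      (hdvd i) (hdvd j) hq hω
  · rw [show ((a i : ℤ) - (a j : ℤ)).natAbs = a i - a j by omega] at hg hq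
    exact exists_gt_card_primeFactors_eq_succ (hpos j) hlt (hg ▸ Nat.gcd_dvd_right _ _)
      (hdvd j) (hdvd i) hq.symm hω.symm
end

section
/- Suppose $a_1, a_2, a_3, a_4, a_5$ are distinct positive integers such that for every pair $1 \leq i < j \leq 5$ one has $\gcd(a_i, a_j) = |a_i - a_j|$ and $\omega\left(\frac{a_i}{|a_i - a_j|}\right) = \omega\left(\frac{a_j}{|a_i - a_j|}\right)$. Let $A = a_1 a_2 a_3 a_4 a_5$ and let $n$ be a positive integer such that $\omega(a_i A n + 1) = \omega(a_j A n + 1)$ for some pair $i \neq j$. Then there exists a positive integer $m$ with $\omega(m) = \omega(m+1)$ and $m > n$. -/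
/-- If `S` and `S + 1` are divisors of `A` with equally many prime factors, and
`ω(d * (S + 1) * A * n + 1) = ω(d * S * A * n + 1)`, then
`m = S * (d * (S + 1) * A * n + 1)` satisfies `ω(m) = ω(m + 1)`. -/
theorem exists_omega_eq_gt_of_consecutive_dvd {d S A n : ℕ} (hd : 0 < d) (hS : 0 < S)
    (hA : 0 < A) (hSA : S ∣ A) (hSA' : S + 1 ∣ A)
    (hω : S.primeFactors.card = (S + 1).primeFactors.card)
    (h : (d * (S + 1) * A * n + 1).primeFactors.card =
      (d * S * A * n + 1).primeFactors.card) :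
    ∃ m : ℕ, 0 < m ∧ m.primeFactors.card = (m + 1).primeFactors.card ∧ m > n := by
  have coprime_of_dvd {x c : ℕ} (hx : x ∣ A) : Nat.Coprime x (c * A * n + 1) := by
    have hdvd : x ∣ c * A * n := Dvd.dvd.mul_right (Dvd.dvd.mul_left hx c) n
    refine Nat.Coprime.coprime_dvd_left hdvd ?_
    simp
  refine ⟨S * (d * (S + 1) * A * n + 1), by positivity, ?_, ?_⟩
  · have hsucc : S * (d * (S + 1) * A * n + 1) + 1 = (S + 1) * (d * S * A * n + 1) := by ring
    have hcop := coprime_of_dvd (c := d * (S + 1)) hSA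
    have hcop' := coprime_of_dvd (c := d * S) hSA'
    rw [hsucc, hcop.primeFactors_mul, hcop'.primeFactors_mul,
      Finset.card_union_of_disjoint hcop.disjoint_primeFactors,
      Finset.card_union_of_disjoint hcop'.disjoint_primeFactors, hω, h]
  · calc n < d * (S + 1) * A * n + 1 :=
          Nat.lt_succ_of_le (Nat.le_mul_of_pos_left n (by positivity))
      _ ≤ _ := Nat.le_mul_of_pos_left _ hS

/-- The reduction of a pair `s < b` with `gcd(s, b) = b - s` to consecutive divisors. -/
theorem exists_omega_eq_gt_of_gcd_eq_sub {s b A n : ℕ} (hs : 0 < s) (hsb : s < b)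
    (hA : 0 < A) (hsA : s ∣ A) (hbA : b ∣ A) (hgcd : Nat.gcd s b = b - s)
    (hω : (s / (b - s)).primeFactors.card = (b / (b - s)).primeFactors.card)
    (h : (b * A * n + 1).primeFactors.card = (s * A * n + 1).primeFactors.card) :
    ∃ m : ℕ, 0 < m ∧ m.primeFactors.card = (m + 1).primeFactors.card ∧ m > n := by
  obtain ⟨d, rfl⟩ := Nat.exists_eq_add_of_lt hsb
  have hsub : s + d + 1 - s = d + 1 := by omega
  rw [hsub] at hgcd hω
  obtain ⟨S, rfl⟩ : d + 1 ∣ s := hgcd ▸ Nat.gcd_dvd_left _ _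
  have hb : (d + 1) * S + d + 1 = (d + 1) * (S + 1) := by ring
  rw [hb] at hbA hω h
  rw [Nat.mul_div_cancel_left _ d.succ_pos, Nat.mul_div_cancel_left _ d.succ_pos] at hω
  exact exists_omega_eq_gt_of_consecutive_dvd d.succ_pos (Nat.pos_of_mul_pos_left hs) hA
    (dvd_of_mul_left_dvd hsA) (dvd_of_mul_left_dvd hbA) hω h


/-- Suppose `a 0, …, a 4` are distinct positive integers such that for every pair `i < j`
one has `gcd(a i, a j) = |a i - a j|` and `ω(a i / |a i - a j|) = ω(a j / |a i - a j|)`.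
Let `A = ∏ i, a i` and let `n` be a positive integer such that
`ω(a i * A * n + 1) = ω(a j * A * n + 1)` for some `i ≠ j`. Then there is a positive
integer `m > n` with `ω(m) = ω(m + 1)`. -/
theorem exists_omega_eq_gt_of_special_quintuple (a : Fin 5 → ℕ)
    (hpos : ∀ i, 0 < a i) (hdist : Function.Injective a)
    (hgcd : ∀ i j, i < j → Nat.gcd (a i) (a j) = ((a i : ℤ) - (a j : ℤ)).natAbs)
    (homega : ∀ i j, i < j →
      (a i / ((a i : ℤ) - (a j : ℤ)).natAbs).primeFactors.card =
        (a j / ((a i : ℤ) - (a j : ℤ)).natAbs).primeFactors.card)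
    (A : ℕ) (hA : A = ∏ i, a i) (n : ℕ) (hn : 0 < n)
    (hex : ∃ i j, i ≠ j ∧
      (a i * A * n + 1).primeFactors.card = (a j * A * n + 1).primeFactors.card) :
    ∃ m : ℕ, 0 < m ∧ m.primeFactors.card = (m + 1).primeFactors.card ∧ m > n := by
  have hApos : 0 < A := hA ▸ Finset.prod_pos fun i _ => hpos i
  have hdvd (i) : a i ∣ A := hA ▸ Finset.dvd_prod_of_mem a (Finset.mem_univ i)
  obtain ⟨i, j, hij, h⟩ := hex
  wlog hlt : i < j generalizing i j
  · exact this j i hij.symm h.symm (lt_of_le_of_ne (not_lt.mp hlt) hij.symm)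
  have hg := hgcd i j hlt
  have hω := homega i j hlt
  rcases lt_or_gt_of_ne (hdist.ne hij) with hl | hl
  · have hd : ((a i : ℤ) - (a j : ℤ)).natAbs = a j - a i := by omega
    rw [hd] at hg hω
    exact exists_omega_eq_gt_of_gcd_eq_sub (hpos i) hl hApos (hdvd i) (hdvd j) hg hω h.symm
  · have hd : ((a i : ℤ) - (a j : ℤ)).natAbs = a i - a j := by omega
    rw [hd] at hg hω
    exact exists_omega_eq_gt_of_gcd_eq_sub (hpos j) hl hApos (hdvd j) (hdvd i)
      (Nat.gcd_comm _ _ ▸ hg) hω.symm h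
end

section
/- Let $a_1 = 135987650281178292389624$, $a_2 = 135987650281178292389625$, $a_3 = 135987650281178292389628$, $a_4 = 135987650281178292389650$, and $a_5 = 135987650281178292390192$. Then for every pair $1 \leq i < j \leq 5$ one has $\gcd(a_i, a_j) = |a_i - a_j|$ and $\omega\left(\frac{a_i}{|a_i - a_j|}\right) = \omega\left(\frac{a_j}{|a_i - a_j|}\right)$. -/
/-- The explicit quintuple found by Schlage-Puchta. -/
def puchtaQuintuple : Fin 5 → ℕ :=
  ![135987650281178292389624, 135987650281178292389625, 135987650281178292389628,
    135987650281178292389650, 135987650281178292390192]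

theorem primeFactors_prod_pow (l : List (ℕ × ℕ)) (hl : ∀ x ∈ l, x.1.Prime ∧ x.2 ≠ 0) :
    (l.map fun x : ℕ × ℕ => x.1 ^ x.2).prod.primeFactors = (l.map Prod.fst).toFinset := by
  induction l with
  | nil => simp
  | cons x l ih =>
    obtain ⟨hx, hl⟩ := List.forall_mem_cons.1 hl
    have hne : (l.map fun x : ℕ × ℕ => x.1 ^ x.2).prod ≠ 0 := by
      rw [Ne, List.prod_eq_zero_iff, List.mem_map]
      rintro ⟨y, hy, h⟩
      exact pow_ne_zero _ (hl y hy).1.ne_zero h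
    rw [List.map_cons, List.prod_cons, List.map_cons, List.toFinset_cons,
      Nat.primeFactors_mul (pow_ne_zero _ hx.1.ne_zero) hne, Nat.primeFactors_prime_pow hx.2 hx.1,
      ih hl, Finset.insert_eq]

theorem primeFactors_eq_of_eq_prod_pow {n : ℕ} (l : List (ℕ × ℕ))
    (hl : ∀ x ∈ l, x.1.Prime ∧ x.2 ≠ 0) (hn : n = (l.map fun x : ℕ × ℕ => x.1 ^ x.2).prod) :
    n.primeFactors = (l.map Prod.fst).toFinset :=
  hn ▸ primeFactors_prod_pow l hl

/-- Modular exponentiation `a ^ k % m` by repeated squaring, for exponents `k < 2 ^ f`. -/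
def powMod (m a : ℕ) : ℕ → ℕ → ℕ
  | 0, _ => 1 % m
  | f + 1, k => powMod m a f (k / 2) ^ 2 % m * a ^ (k % 2) % m

theorem powMod_eq {m a f k : ℕ} (hk : k < 2 ^ f) : powMod m a f k = a ^ k % m := by
  induction f generalizing k with
  | zero =>
    obtain rfl : k = 0 := by simpa using hk
    simp [powMod]
  | succ f ih =>
    rw [powMod, ih (by rw [pow_succ] at hk; omega), ← Nat.pow_mod, Nat.mod_mul_mod, ← pow_mul,
      ← pow_add, mul_comm, Nat.div_add_mod]

/-- Lucas' primality criterion, from a prime factorization `l` of `p - 1` and a primitive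
root `a`. -/
theorem prime_of_primitive_root {p : ℕ} (a : ℕ) (l : List (ℕ × ℕ))
    (hl : ∀ x ∈ l, x.1.Prime ∧ x.2 ≠ 0) (hp : p - 1 = (l.map fun x : ℕ × ℕ => x.1 ^ x.2).prod)
    (hp0 : p - 1 ≠ 0) (f : ℕ) (hf : p - 1 < 2 ^ f) (ha : powMod p a f (p - 1) = 1)
    (hd : ∀ x ∈ l, powMod p a f ((p - 1) / x.1) ≠ 1) : p.Prime := by
  have key {k : ℕ} (hk : k ≤ p - 1) : (a : ZMod p) ^ k = 1 ↔ powMod p a f k = 1 := by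
    rw [powMod_eq (hk.trans_lt hf), ← Nat.cast_pow, ← Nat.cast_one,
      ZMod.natCast_eq_natCast_iff', Nat.mod_eq_of_lt (a := 1)]
    omega
  refine lucas_primality p a ((key le_rfl).2 ha) fun q hq hqp => ?_
  have hmem : q ∈ (l.map Prod.fst).toFinset := by
    rw [← primeFactors_eq_of_eq_prod_pow l hl hp]
    exact Nat.mem_primeFactors.2 ⟨hq, hqp, hp0⟩
  obtain ⟨x, hx, rfl⟩ := List.mem_map.1 (List.mem_toFinset.1 hmem)
  rw [Ne, key (Nat.div_le_self _ _)]
  exact hd x hx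

theorem prime_28311976573 : Nat.Prime 28311976573 := by
  refine prime_of_primitive_root 5 [(2, 2), (3, 1), (11, 1), (37, 1), (499, 1), (11617, 1)] ?_
    (by norm_num) (by norm_num) 35 (by norm_num) (by decide +kernel) (by decide +kernel)
  norm_num

theorem prime_1720429 : Nat.Prime 1720429 := by
  refine prime_of_primitive_root 2 [(2, 2), (3, 1), (307, 1), (467, 1)] ?_
    (by norm_num) (by norm_num) 21 (by norm_num) (by decide +kernel) (by decide +kernel)
  norm_num

theorem prime_82951537 : Nat.Prime 82951537 := by
  refine prime_of_primitive_root 5 [(2, 4), (3, 1), (31, 1), (107, 1), (521, 1)] ?_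
    (by norm_num) (by norm_num) 27 (by norm_num) (by decide +kernel) (by decide +kernel)
  norm_num

theorem prime_1327224593 : Nat.Prime 1327224593 := by
  refine prime_of_primitive_root 3 [(2, 4), (82951537, 1)] ?_
    (by norm_num) (by norm_num) 31 (by norm_num) (by decide +kernel) (by decide +kernel)
  simp only [List.forall_mem_cons, prime_82951537]
  norm_num

theorem prime_1145107 : Nat.Prime 1145107 := by
  refine prime_of_primitive_root 2 [(2, 1), (3, 2), (63617, 1)] ?_
    (by norm_num) (by norm_num) 21 (by norm_num) (by decide +kernel) (by decide +kernel)
  norm_num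

theorem prime_293245787 : Nat.Prime 293245787 := by
  refine prime_of_primitive_root 2 [(2, 1), (307, 1), (433, 1), (1103, 1)] ?_
    (by norm_num) (by norm_num) 29 (by norm_num) (by decide +kernel) (by decide +kernel)
  norm_num

theorem prime_28189904497 : Nat.Prime 28189904497 := by
  refine prime_of_primitive_root 5 [(2, 4), (3, 1), (13, 1), (19, 1), (269, 1), (8839, 1)] ?_
    (by norm_num) (by norm_num) 35 (by norm_num) (by decide +kernel) (by decide +kernel)
  norm_num

theorem prime_2367951977749 : Nat.Prime 2367951977749 := by
  refine prime_of_primitive_root 2 [(2, 2), (3, 1), (7, 1), (28189904497, 1)] ?_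
    (by norm_num) (by norm_num) 42 (by norm_num) (by decide +kernel) (by decide +kernel)
  simp only [List.forall_mem_cons, prime_28189904497]
  norm_num

theorem primeFactors_puchtaQuintuple_zero :
    (puchtaQuintuple 0).primeFactors =
      {2, 13, 29, 71, 431, 733, 28311976573} := by
  refine (primeFactors_eq_of_eq_prod_pow
    [(2, 3), (13, 1), (29, 1), (71, 2), (431, 1), (733, 1), (28311976573, 1)]
    ?_ ?_).trans ?_
  · simp only [List.forall_mem_cons, prime_28311976573]
    norm_num
  · decide +kernel
  · rfl

theorem primeFactors_puchtaQuintuple_one :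
    (puchtaQuintuple 1).primeFactors =
      {3, 5, 7, 1481, 3109, 80737, 1720429} := by
  refine (primeFactors_eq_of_eq_prod_pow
    [(3, 5), (5, 3), (7, 1), (1481, 1), (3109, 1), (80737, 1), (1720429, 1)]
    ?_ ?_).trans ?_
  · simp only [List.forall_mem_cons, prime_1720429]
    norm_num
  · decide +kernel
  · rfl

theorem primeFactors_puchtaQuintuple_two :
    (puchtaQuintuple 2).primeFactors =
      {2, 3, 11, 31, 47, 53, 6899, 1327224593} := by
  refine (primeFactors_eq_of_eq_prod_pow
    [(2, 2), (3, 1), (11, 1), (31, 2), (47, 2), (53, 1), (6899, 1), (1327224593, 1)]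
    ?_ ?_).trans ?_
  · simp only [List.forall_mem_cons, prime_1327224593]
    norm_num
  · decide +kernel
  · rfl

theorem primeFactors_puchtaQuintuple_three :
    (puchtaQuintuple 3).primeFactors =
      {2, 5, 11, 13, 19, 271, 1145107, 293245787} := by
  refine (primeFactors_eq_of_eq_prod_pow
    [(2, 1), (5, 2), (11, 2), (13, 1), (19, 1), (271, 1), (1145107, 1), (293245787, 1)]
    ?_ ?_).trans ?_
  · simp only [List.forall_mem_cons, prime_1145107, prime_293245787]
    norm_num
  · decide +kernel
  · rfl

theorem primeFactors_puchtaQuintuple_four :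
    (puchtaQuintuple 4).primeFactors =
      {2, 3, 7, 47, 71, 271, 2367951977749} := by
  refine (primeFactors_eq_of_eq_prod_pow
    [(2, 4), (3, 4), (7, 2), (47, 1), (71, 1), (271, 1), (2367951977749, 1)]
    ?_ ?_).trans ?_
  · simp only [List.forall_mem_cons, prime_2367951977749]
    norm_num
  · decide +kernel
  · rfl

theorem card_primeFactors_div {n d : ℕ} (hn : n ≠ 0) (hd : d ∣ n) :
    (n / d).primeFactors.card = (n.primeFactors.filter (· ∣ n / d)).card := by
  rw [Nat.primeFactors_filter_dvd_of_dvd hn (Nat.div_dvd_of_dvd hd)]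

/-- For the explicit quintuple `a 0 < a 1 < a 2 < a 3 < a 4`, every pair `i < j`
satisfies `gcd(a i, a j) = a j - a i` and `ω(a i / (a j - a i)) = ω(a j / (a j - a i))`. -/
theorem puchtaQuintuple_property :
    ∀ i j : Fin 5, i < j →
      Nat.gcd (puchtaQuintuple i) (puchtaQuintuple j) = puchtaQuintuple j - puchtaQuintuple i ∧
      (puchtaQuintuple i / (puchtaQuintuple j - puchtaQuintuple i)).primeFactors.card =
        (puchtaQuintuple j / (puchtaQuintuple j - puchtaQuintuple i)).primeFactors.card := by
  intro i j hij
  have hgcd : Nat.gcd (puchtaQuintuple i) (puchtaQuintuple j) =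
      puchtaQuintuple j - puchtaQuintuple i := by
    revert i j
    decide
  have hpos (k : Fin 5) : puchtaQuintuple k ≠ 0 := by
    revert k
    decide
  refine ⟨hgcd, ?_⟩
  rw [card_primeFactors_div (hpos i) (hgcd ▸ Nat.gcd_dvd_left _ _),
    card_primeFactors_div (hpos j) (hgcd ▸ Nat.gcd_dvd_right _ _)]
  clear hgcd hpos
  fin_cases i <;> fin_cases j <;> first
    | exact absurd hij (by decide)
    | simp only [Fin.zero_eta, Fin.mk_one, Fin.reduceFinMk, primeFactors_puchtaQuintuple_zero,
        primeFactors_puchtaQuintuple_one, primeFactors_puchtaQuintuple_two,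
        primeFactors_puchtaQuintuple_three, primeFactors_puchtaQuintuple_four]
      decide +kernel
end
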